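/- arXiv:1404.5985 — 2 statements merged into one kernel-verified Lean document; each statement's English description precedes it below -/
import Mathlib

section
/- For every odd n ∈ ℤ⁺, there is no RTAM system 𝒯 = (T, σ, 1) at temperature 1 with |T| < n and |dom σ| = 1 such that 𝒯 weakly (or strictly) self-assembles an n × n square. -/
/-! # Reflexive Tile Assembly Model (RTAM) -/

/-- A glue: `none` is the null glue; `some (l, s)` has label `l : ℤ` and strength `s : ℕ`.
The complement of the label `l` is `-l`. -/
abbrev Glue : Type := Option (ℤ × ℕ)

/-- Strength with which two abutting glues bind: `s` if the labels are complementary and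
the strengths are both equal to `s`, and `0` otherwise. -/
def glueBind : Glue → Glue → ℕ
  | some (l₁, s₁), some (l₂, s₂) => if l₂ = -l₁ ∧ s₂ = s₁ then s₁ else 0
  | _, _ => 0

/-- Two abutting glues match (for mismatch-freeness): both null, or complementary labels
with equal strengths. -/
def GlueMatch (g h : Glue) : Prop :=
  (g = none ∧ h = none) ∨ ∃ l s, g = some (l, s) ∧ h = some (-l, s)

/-- A tile type: glues on the north, east, south and west sides (in that order). -/
abbrev TileType : Type := Glue × Glue × Glue × Glue

def TileType.north (t : TileType) : Glue := t.1
def TileType.east (t : TileType) : Glue := t.2.1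
def TileType.south (t : TileType) : Glue := t.2.2.1
def TileType.west (t : TileType) : Glue := t.2.2.2

/-- A reflection `(h, v)`: `h` indicates a flip across the vertical axis (swapping east and
west and negating `x`), `v` a flip across the horizontal axis (swapping north and south and
negating `y`).  `D = (false, false)`, `H = (true, false)`, `V = (false, true)`,
`B = (true, true)`. -/
abbrev Reflection : Type := Bool × Bool

/-- Composition of reflections (the Klein four-group). -/
def Reflection.comp (r s : Reflection) : Reflection := (xor r.1 s.1, xor r.2 s.2)

/-- The action of a reflection on a point of `ℤ²`. -/
def Reflection.onPoint (r : Reflection) (p : ℤ × ℤ) : ℤ × ℤ :=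
  (if r.1 then -p.1 else p.1, if r.2 then -p.2 else p.2)

/-- The tile type obtained by reflecting `t` according to `r` (glues are unchanged, sides
are permuted). -/
def TileType.reflect (t : TileType) (r : Reflection) : TileType :=
  (if r.2 then TileType.south t else TileType.north t,
   if r.1 then TileType.west t else TileType.east t,
   if r.2 then TileType.north t else TileType.south t,
   if r.1 then TileType.east t else TileType.west t)

/-- A placed tile: a tile type together with its reflection. -/
abbrev Placement : Type := TileType × Reflection

/-- An assembly: a partial function from `ℤ²` to placed tiles. -/
abbrev Assembly : Type := ℤ × ℤ → Option Placement

/-- The domain of an assembly. -/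
def adom (α : Assembly) : Set (ℤ × ℤ) := {p | α p ≠ none}

/-- The glue presented by the placed tile `pl` at position `p` on the side facing
position `q` (the null glue if `q` is not adjacent to `p`). -/
def facingGlue (pl : Placement) (p q : ℤ × ℤ) : Glue :=
  if q = (p.1 + 1, p.2) then TileType.east (TileType.reflect pl.1 pl.2)
  else if q = (p.1 - 1, p.2) then TileType.west (TileType.reflect pl.1 pl.2)
  else if q = (p.1, p.2 + 1) then TileType.north (TileType.reflect pl.1 pl.2)
  else if q = (p.1, p.2 - 1) then TileType.south (TileType.reflect pl.1 pl.2)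
  else none

/-- The strength of the bond between the tiles of `α` at positions `p` and `q`. -/
def bondStrength (α : Assembly) (p q : ℤ × ℤ) : ℕ :=
  match α p, α q with
  | some a, some b => glueBind (facingGlue a p q) (facingGlue b q p)
  | _, _ => 0

/-- Adjacency in the binding graph of `α`. -/
def BondAdj (α : Assembly) (p q : ℤ × ℤ) : Prop := 0 < bondStrength α p q

/-- `α` is `τ`-stable: every cut of its binding graph has total strength at least `τ`
(i.e. some finite set of crossing edges already has total strength at least `τ`). -/
def Stable (α : Assembly) (τ : ℕ) : Prop :=
  ∀ A : Set (ℤ × ℤ), A ⊆ adom α → A.Nonempty → (adom α \ A).Nonempty →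
    ∃ E : Finset ((ℤ × ℤ) × (ℤ × ℤ)),
      (∀ e ∈ E, e.1 ∈ A ∧ e.2 ∈ adom α \ A) ∧
      τ ≤ ∑ e ∈ E, bondStrength α e.1 e.2

/-- An RTAM tile assembly system: a finite tile set, a finite stable seed assembly, and a
temperature. -/
structure RTAS where
  tiles : Finset TileType
  seed : Assembly
  temp : ℕ
  seed_nonempty : (adom seed).Nonempty
  seed_finite : (adom seed).Finite
  seed_tiles : ∀ p pl, seed p = some pl → pl.1 ∈ tiles
  seed_stable : Stable seed temp

/-- `β` is obtained from `α` by `τ`-stably attaching a single tile (in any reflection) at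
an empty position. -/
def Attaches (S : RTAS) (α β : Assembly) : Prop :=
  ∃ (p : ℤ × ℤ) (t : TileType) (r : Reflection),
    α p = none ∧ t ∈ S.tiles ∧ β = Function.update α p (some (t, r)) ∧ Stable β S.temp

/-- Producible assemblies: those reachable from the seed in finitely many attachment steps
or in the limit. -/
def Producible (S : RTAS) (α : Assembly) : Prop :=
  ∃ f : ℕ → Assembly, f 0 = S.seed ∧
    (∀ n, f (n + 1) = f n ∨ Attaches S (f n) (f (n + 1))) ∧
    (∀ p pl, α p = some pl ↔ ∃ n, f n p = some pl)

/-- Terminal assemblies: producible assemblies admitting no further attachment. -/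
def Terminal (S : RTAS) (α : Assembly) : Prop :=
  Producible S α ∧ ∀ β, ¬ Attaches S α β

/-- Apply the reflection `r` and then the translation `v` to the assembly `α`. -/
def transform (α : Assembly) (r : Reflection) (v : ℤ × ℤ) : Assembly :=
  fun p => (α (Reflection.onPoint r (p - v))).map fun pl => (pl.1, Reflection.comp r pl.2)

/-- The configuration of an assembly: forget the reflections of the placed tiles. -/
def config (α : Assembly) : ℤ × ℤ → Option TileType := fun p => (α p).map Prod.fst

/-- A system is directed if any two producible assemblies have the same configuration up
to a reflection and a translation. -/
def RTASDirected (S : RTAS) : Prop :=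
  ∀ α β, Producible S α → Producible S β →
    ∃ (r : Reflection) (v : ℤ × ℤ), config (transform β r v) = config α

/-- A system is singly seeded if its seed consists of a single tile. -/
def SinglySeeded (S : RTAS) : Prop := ∃ p, adom S.seed = {p}

/-- `X` weakly self-assembles in `S`. -/
def WeaklySelfAssembles (S : RTAS) (X : Set (ℤ × ℤ)) : Prop :=
  ∃ B ⊆ S.tiles, ∀ α, Terminal S α →
    ∃ (r : Reflection) (v : ℤ × ℤ),
      {p | ∃ pl, transform α r v p = some pl ∧ pl.1 ∈ B} = X

/-- `X` strictly self-assembles in `S`. -/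
def StrictlySelfAssembles (S : RTAS) (X : Set (ℤ × ℤ)) : Prop :=
  ∀ α, Terminal S α →
    ∃ (r : Reflection) (v : ℤ × ℤ), adom (transform α r v) = X

/-- A semi-doubly periodic subset of `ℤ²`. -/
def SemiDoublyPeriodic (X : Set (ℤ × ℤ)) : Prop :=
  ∃ b u v : ℤ × ℤ, X = {p | ∃ n m : ℕ, p = b + (n : ℤ) • u + (m : ℤ) • v}

/-- A finite union of semi-doubly periodic sets. -/
def FiniteUnionSDP (X : Set (ℤ × ℤ)) : Prop :=
  ∃ (k : ℕ) (f : Fin k → Set (ℤ × ℤ)),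
    (∀ i, SemiDoublyPeriodic (f i)) ∧ X = ⋃ i, f i

/-- The box of radius `c` centered at `v`. -/
def box (c : ℕ) (v : ℤ × ℤ) : Set (ℤ × ℤ) :=
  {p | |p.1 - v.1| ≤ (c : ℤ) ∧ |p.2 - v.2| ≤ (c : ℤ)}

/-- The `n × m` rectangle `{0, …, n−1} × {0, …, m−1} ⊆ ℤ²`. -/
def rectShape (n m : ℕ) : Set (ℤ × ℤ) :=
  {p | 0 ≤ p.1 ∧ p.1 < (n : ℤ) ∧ 0 ≤ p.2 ∧ p.2 < (m : ℤ)}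

/-- The `n × n` square `{0, …, n−1}² ⊆ ℤ²`. -/
def squareShape (n : ℕ) : Set (ℤ × ℤ) := rectShape n n

/-- Grid adjacency on `ℤ²`. -/
def GridAdj (p q : ℤ × ℤ) : Prop := (p.1 - q.1).natAbs + (p.2 - q.2).natAbs = 1

/-- `X` is connected in the grid graph. -/
def GridConnectedOn (X : Set (ℤ × ℤ)) : Prop :=
  ∀ p ∈ X, ∀ q ∈ X, Relation.ReflTransGen (fun a b => GridAdj a b ∧ a ∈ X ∧ b ∈ X) p q

/-- A shape: a finite nonempty connected subset of `ℤ²`. -/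
def IsShape (X : Set (ℤ × ℤ)) : Prop := X.Finite ∧ X.Nonempty ∧ GridConnectedOn X

/-- A system is mismatch-free: in every producible assembly, abutting sides of adjacent
tiles are either both null or carry complementary glues of equal strength. -/
def MismatchFree (S : RTAS) : Prop :=
  ∀ α, Producible S α → ∀ p q a b, GridAdj p q → α p = some a → α q = some b →
    GlueMatch (facingGlue a p q) (facingGlue b q p)

/-- `X` is odd-symmetric with respect to some horizontal or vertical line through lattice
points. -/
def OddSymmetric (X : Set (ℤ × ℤ)) : Prop :=
  (∃ l : ℤ, ∀ a b : ℤ, ((a, l - b) ∈ X ↔ (a, l + b) ∈ X)) ∨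
  (∃ l : ℤ, ∀ a b : ℤ, ((l - a, b) ∈ X ↔ (l + a, b) ∈ X))

/-- The binding graph of `α` is a tree: connected on `adom α` and every edge is a bridge. -/
def BindingGraphIsTree (α : Assembly) : Prop :=
  (∀ p ∈ adom α, ∀ q ∈ adom α, Relation.ReflTransGen (BondAdj α) p q) ∧
  (∀ p q, BondAdj α p q →
    ¬ Relation.ReflTransGen
      (fun a b => BondAdj α a b ∧ ¬((a = p ∧ b = q) ∨ (a = q ∧ b = p))) p q)

/-- A spanning tree of the grid graph of a shape `X`. -/
structure TreeOf (X : Set (ℤ × ℤ)) where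
  adj : ℤ × ℤ → ℤ × ℤ → Prop
  symm : ∀ p q, adj p q → adj q p
  valid : ∀ p q, adj p q → p ∈ X ∧ q ∈ X ∧ GridAdj p q
  connected : ∀ p ∈ X, ∀ q ∈ X, Relation.ReflTransGen adj p q
  acyclic : ∀ p q, adj p q →
    ¬ Relation.ReflTransGen
      (fun a b => adj a b ∧ ¬((a = p ∧ b = q) ∨ (a = q ∧ b = p))) p q

/-- The vertex set of a horizontal axis at height `l` from `x₁` to `x₂`. -/
def hAxisSet (l x₁ x₂ : ℤ) : Set (ℤ × ℤ) := {p | p.2 = l ∧ x₁ ≤ p.1 ∧ p.1 ≤ x₂}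

/-- The vertex set of a vertical axis at abscissa `l` from `y₁` to `y₂`. -/
def vAxisSet (l y₁ y₂ : ℤ) : Set (ℤ × ℤ) := {p | p.1 = l ∧ y₁ ≤ p.2 ∧ p.2 ≤ y₂}

/-- A (maximal) horizontal axis of the tree `t`: consecutive vertices on the line `y = l`
joined by tree edges, not extendable on either end. -/
def IsHAxis {X : Set (ℤ × ℤ)} (t : TreeOf X) (l x₁ x₂ : ℤ) : Prop :=
  x₁ ≤ x₂ ∧ (∀ x, x₁ ≤ x → x ≤ x₂ → ((x, l) : ℤ × ℤ) ∈ X) ∧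
  (∀ x, x₁ ≤ x → x < x₂ → t.adj (x, l) (x + 1, l)) ∧
  ¬ t.adj (x₁ - 1, l) (x₁, l) ∧ ¬ t.adj (x₂, l) (x₂ + 1, l)

/-- A (maximal) vertical axis of the tree `t`. -/
def IsVAxis {X : Set (ℤ × ℤ)} (t : TreeOf X) (l y₁ y₂ : ℤ) : Prop :=
  y₁ ≤ y₂ ∧ (∀ y, y₁ ≤ y → y ≤ y₂ → ((l, y) : ℤ × ℤ) ∈ X) ∧
  (∀ y, y₁ ≤ y → y < y₂ → t.adj (l, y) (l, y + 1)) ∧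
  ¬ t.adj (l, y₁ - 1) (l, y₁) ∧ ¬ t.adj (l, y₂) (l, y₂ + 1)

/-- The union of the axial branches of `t` beginning from `v` relative to the axis `a`
(together with `v` itself): everything reachable from `v` through a neighbor not on `a`
without revisiting `v`. -/
def branch {X : Set (ℤ × ℤ)} (t : TreeOf X) (a : Set (ℤ × ℤ)) (v : ℤ × ℤ) :
    Set (ℤ × ℤ) :=
  {v} ∪ {p | ∃ w, t.adj v w ∧ w ∉ a ∧
    Relation.ReflTransGen (fun x y => t.adj x y ∧ x ≠ v ∧ y ≠ v) w p}

/-- The axial branches of `t` beginning from `v` are symmetric across the reflection `ρ`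
(of `ℤ²` across the line of the axis `a`). -/
def BranchSymmetric {X : Set (ℤ × ℤ)} (t : TreeOf X) (a : Set (ℤ × ℤ))
    (ρ : ℤ × ℤ → ℤ × ℤ) (v : ℤ × ℤ) : Prop :=
  (∀ p ∈ branch t a v, ρ p ∈ branch t a v) ∧
  (∀ p q, p ∈ branch t a v → q ∈ branch t a v → t.adj p q → t.adj (ρ p) (ρ q))

/-- `t` is off-by-one symmetric across the horizontal axis determined by `(l, x₁, x₂)`:
the branches from every vertex of the axis, except at most one, are symmetric across it. -/
def OffByOneH {X : Set (ℤ × ℤ)} (t : TreeOf X) (l x₁ x₂ : ℤ) : Prop :=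
  ∃ v₀ : ℤ × ℤ, ∀ x, x₁ ≤ x → x ≤ x₂ → ((x, l) : ℤ × ℤ) ≠ v₀ →
    BranchSymmetric t (hAxisSet l x₁ x₂) (fun p => (p.1, 2 * l - p.2)) (x, l)

/-- `t` is off-by-one symmetric across the vertical axis determined by `(l, y₁, y₂)`. -/
def OffByOneV {X : Set (ℤ × ℤ)} (t : TreeOf X) (l y₁ y₂ : ℤ) : Prop :=
  ∃ v₀ : ℤ × ℤ, ∀ y, y₁ ≤ y → y ≤ y₂ → ((l, y) : ℤ × ℤ) ≠ v₀ →
    BranchSymmetric t (vAxisSet l y₁ y₂) (fun p => (2 * l - p.1, p.2)) (l, y)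

/-- A tree is ε-symmetric if it is off-by-one symmetric across each of its axes. -/
def TreeOf.EpsSymmetric {X : Set (ℤ × ℤ)} (t : TreeOf X) : Prop :=
  (∀ l x₁ x₂, IsHAxis t l x₁ x₂ → OffByOneH t l x₁ x₂) ∧
  (∀ l y₁ y₂, IsVAxis t l y₁ y₂ → OffByOneV t l y₁ y₂)

/-- A shape is ε-symmetric if some spanning tree of its grid graph is ε-symmetric. -/
def EpsSymmetricShape (X : Set (ℤ × ℤ)) : Prop :=
  ∃ t : TreeOf X, TreeOf.EpsSymmetric t

/-- The `c`-scaling of a shape: replace each point by a `c × c` block. -/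
def scaleShape (X : Set (ℤ × ℤ)) (c : ℕ) : Set (ℤ × ℤ) :=
  {p | (Int.fdiv p.1 (c : ℤ), Int.fdiv p.2 (c : ℤ)) ∈ X}

/-- The assembly encoded by a finite list of placed tiles. -/
def listAssembly (L : List ((ℤ × ℤ) × Placement)) : Assembly :=
  fun p => (L.find? fun e => decide (e.1 = p)).map Prod.snd

/-! ## Sides, directions and reflections -/

/-- A side of a tile, or a direction of the plane: an axis (`false` horizontal, `true` vertical)
together with a sign (`true` positive). -/
abbrev Side : Type := Bool × Bool

/-- The glue of a tile type on a side. -/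
def TileType.glueOn (t : TileType) (s : Side) : Glue :=
  if s.1 then (if s.2 then t.north else t.south) else (if s.2 then t.east else t.west)

/-- The action of a reflection on sides. -/
def Reflection.onSide (r : Reflection) (s : Side) : Side :=
  (s.1, xor s.2 (if s.1 then r.2 else r.1))

/-- The opposite side. -/
def Side.opp (s : Side) : Side := (s.1, !s.2)

/-- The unit vector in direction `s`. -/
def Side.step (s : Side) : ℤ × ℤ :=
  if s.1 then (0, if s.2 then 1 else -1) else (if s.2 then 1 else -1, 0)

/-- The direction along axis `a` pointing into the quadrant `σ`. -/
def sideInto (σ : Bool × Bool) (a : Bool) : Side := (a, if a then σ.2 else σ.1)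

/-- The opposite quadrant. -/
def oppQuadrant (σ : Bool × Bool) : Bool × Bool := (!σ.1, !σ.2)

/-- The direction from `p` to an adjacent point `q`. -/
def dirTo (p q : ℤ × ℤ) : Side :=
  (decide (q.1 = p.1), decide (p.1 < q.1 ∨ p.2 < q.2))

theorem dirTo_step (p : ℤ × ℤ) (s : Side) : dirTo p (p + Side.step s) = s := by
  obtain ⟨_ | _, _ | _⟩ := s <;> simp [dirTo, Side.step]

theorem dirTo_step_symm (p : ℤ × ℤ) (s : Side) : dirTo (p + Side.step s) p = Side.opp s := by
  obtain ⟨_ | _, _ | _⟩ := s <;> simp [dirTo, Side.step, Side.opp]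

theorem Reflection.onSide_onSide (r : Reflection) (s : Side) :
    Reflection.onSide r (Reflection.onSide r s) = s := by
  revert r s; decide

theorem Reflection.onSide_injective (r : Reflection) : Function.Injective (Reflection.onSide r) :=
  Function.LeftInverse.injective (Reflection.onSide_onSide r)

theorem TileType.glueOn_reflect (t : TileType) (r : Reflection) (s : Side) :
    TileType.glueOn (t.reflect r) s = TileType.glueOn t (Reflection.onSide r s) := by
  obtain ⟨_ | _, _ | _⟩ := s <;> obtain ⟨_ | _, _ | _⟩ := r <;> rfl

theorem facingGlue_step (a : Placement) (p : ℤ × ℤ) (s : Side) :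
    facingGlue a p (p + Side.step s) = TileType.glueOn a.1 (Reflection.onSide a.2 s) := by
  rw [← TileType.glueOn_reflect]
  obtain ⟨_ | _, _ | _⟩ := s <;> obtain ⟨x, y⟩ := p <;>
    simp [facingGlue, Side.step, TileType.glueOn] <;> intros <;> omega

theorem facingGlue_step_symm (a : Placement) (p : ℤ × ℤ) (s : Side) :
    facingGlue a (p + Side.step s) p =
      TileType.glueOn a.1 (Reflection.onSide a.2 (Side.opp s)) := by
  rw [← facingGlue_step a (p + Side.step s) (Side.opp s)]
  congr 1
  obtain ⟨_ | _, _ | _⟩ := s <;> obtain ⟨x, y⟩ := p <;> simp [Side.step, Side.opp]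

theorem eq_step_of_facingGlue_ne_none {a : Placement} {p q : ℤ × ℤ}
    (h : facingGlue a p q ≠ none) : ∃ s, q = p + Side.step s := by
  unfold facingGlue at h
  split_ifs at h with h1 h2 h3 h4
  · exact ⟨(false, true), by rw [h1]; simp [Side.step, Prod.ext_iff]⟩
  · exact ⟨(false, false), by rw [h2]; simp [Side.step, Prod.ext_iff, sub_eq_add_neg]⟩
  · exact ⟨(true, true), by rw [h3]; simp [Side.step, Prod.ext_iff]⟩
  · exact ⟨(true, false), by rw [h4]; simp [Side.step, Prod.ext_iff, sub_eq_add_neg]⟩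
  · exact absurd rfl h

theorem glueBind_comm (g h : Glue) : glueBind g h = glueBind h g := by
  rcases g with _ | ⟨l, s⟩ <;> rcases h with _ | ⟨l', s'⟩ <;> simp only [glueBind]
  by_cases h : l' = -l ∧ s' = s
  · obtain ⟨rfl, rfl⟩ := h
    simp
  · rw [if_neg h, if_neg]
    rintro ⟨rfl, rfl⟩
    simp at h

theorem bondStrength_comm (α : Assembly) (p q : ℤ × ℤ) :
    bondStrength α p q = bondStrength α q p := by
  unfold bondStrength
  rcases α p with _ | a <;> rcases α q with _ | b <;> simp [glueBind_comm]

theorem BondAdj.symm {α : Assembly} {p q : ℤ × ℤ} (h : BondAdj α p q) : BondAdj α q p := by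
  unfold BondAdj at *
  rwa [bondStrength_comm]

theorem bondStrength_step {α : Assembly} {p : ℤ × ℤ} {s : Side} {a b : Placement}
    (ha : α p = some a) (hb : α (p + Side.step s) = some b) :
    bondStrength α p (p + Side.step s) =
      glueBind (TileType.glueOn a.1 (Reflection.onSide a.2 s))
        (TileType.glueOn b.1 (Reflection.onSide b.2 (Side.opp s))) := by
  unfold bondStrength
  rw [ha, hb]
  simp only [facingGlue_step, facingGlue_step_symm]

theorem BondAdj.exists_step {α : Assembly} {p q : ℤ × ℤ} (h : BondAdj α p q) :
    ∃ s a b, q = p + Side.step s ∧ α p = some a ∧ α q = some b ∧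
      0 < glueBind (TileType.glueOn a.1 (Reflection.onSide a.2 s))
        (TileType.glueOn b.1 (Reflection.onSide b.2 (Side.opp s))) := by
  rcases ha : α p with _ | a
  · simp [BondAdj, bondStrength, ha] at h
  rcases hb : α q with _ | b
  · simp [BondAdj, bondStrength, ha, hb] at h
  have hs : ∃ s, q = p + Side.step s := by
    refine eq_step_of_facingGlue_ne_none (a := a) fun h0 => ?_
    simp [BondAdj, bondStrength, ha, hb, h0, glueBind] at h
  obtain ⟨s, rfl⟩ := hs
  refine ⟨s, a, b, rfl, rfl, rfl, ?_⟩
  rwa [BondAdj, bondStrength_step ha hb] at h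

theorem BondAdj.mono {α β : Assembly} (hle : ∀ p a, α p = some a → β p = some a)
    {p q : ℤ × ℤ} (h : BondAdj α p q) : BondAdj β p q := by
  obtain ⟨s, a, b, rfl, ha, hb, hpos⟩ := h.exists_step
  rwa [BondAdj, bondStrength_step (hle _ _ ha) (hle _ _ hb)]

theorem BondAdj.ne {α : Assembly} {p q : ℤ × ℤ} (h : BondAdj α p q) : p ≠ q := by
  obtain ⟨⟨_ | _, _ | _⟩, a, b, rfl, -⟩ := h.exists_step <;> simp [Side.step]

/-! ## Stability at temperature 1 -/

theorem stable_one_iff {α : Assembly} : Stable α 1 ↔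
    ∀ A : Set (ℤ × ℤ), A ⊆ adom α → A.Nonempty → (adom α \ A).Nonempty →
      ∃ p ∈ A, ∃ q ∈ adom α \ A, BondAdj α p q := by
  refine ⟨fun h A hA h1 h2 => ?_, fun h A hA h1 h2 => ?_⟩
  · obtain ⟨E, hE, hsum⟩ := h A hA h1 h2
    obtain ⟨e, he, hpos⟩ : ∃ e ∈ E, 0 < bondStrength α e.1 e.2 := by
      by_contra! hc
      rw [Finset.sum_eq_zero fun e he => Nat.le_zero.mp (hc e he)] at hsum
      omega
    exact ⟨e.1, (hE e he).1, e.2, (hE e he).2, hpos⟩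
  · obtain ⟨p, hp, q, hq, hpq⟩ := h A hA h1 h2
    refine ⟨{(p, q)}, by simpa using ⟨hp, hq⟩, ?_⟩
    simpa [BondAdj, Nat.one_le_iff_ne_zero, Nat.pos_iff_ne_zero] using hpq

theorem stable_update {α : Assembly} (hα : Stable α 1) {p q : ℤ × ℤ} {a : Placement}
    (hp : α p = none) (hb : BondAdj (Function.update α p (some a)) p q) :
    Stable (Function.update α p (some a)) 1 := by
  have hle : ∀ x b, α x = some b → Function.update α p (some a) x = some b := by
    intro x b hx
    rwa [Function.update_of_ne]
    rintro rfl
    simp [hp] at hx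
  have hdom : ∀ x, x ∈ adom (Function.update α p (some a)) ↔ x = p ∨ x ∈ adom α := by
    intro x
    by_cases hx : x = p
    · subst hx; simp [adom]
    · simp [adom, hx]
  have hpn : p ∉ adom α := by simp [adom, hp]
  have hqd : q ∈ adom α := by
    obtain ⟨s, b, c, hq, -, hc, -⟩ := hb.exists_step
    have := (hdom q).1 (by simp [adom, hc])
    exact this.resolve_left hb.ne.symm
  rw [stable_one_iff] at hα ⊢
  intro A hA ⟨x, hx⟩ ⟨y, hy, hyA⟩
  by_cases hpA : p ∈ A
  · have hyα : y ∈ adom α := ((hdom y).1 hy).resolve_left fun h => hyA (h ▸ hpA)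
    by_cases hqA : q ∈ A
    · obtain ⟨u, hu, v, hv, huv⟩ := hα (A \ {p})
        (fun z hz => ((hdom z).1 (hA hz.1)).resolve_left hz.2)
        ⟨q, hqA, hb.ne.symm⟩ ⟨y, hyα, fun h => hyA h.1⟩
      exact ⟨u, hu.1, v, ⟨(hdom v).2 (Or.inr hv.1),
        fun h => hv.2 ⟨h, fun h' => hpn (h' ▸ hv.1)⟩⟩, huv.mono hle⟩
    · exact ⟨p, hpA, q, ⟨(hdom q).2 (Or.inr hqd), hqA⟩, hb⟩
  · have hAα : A ⊆ adom α := fun z hz => ((hdom z).1 (hA hz)).resolve_left fun h => hpA (h ▸ hz)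
    by_cases hqA : q ∈ A
    · exact ⟨q, hqA, p, ⟨(hdom p).2 (Or.inl rfl), hpA⟩, hb.symm⟩
    · obtain ⟨u, hu, v, hv, huv⟩ := hα A hAα ⟨x, hx⟩ ⟨q, hqd, hqA⟩
      exact ⟨u, hu, v, ⟨(hdom v).2 (Or.inr hv.1), hv.2⟩, huv.mono hle⟩

theorem reflTransGen_bondAdj_of_stable {α : Assembly} (hα : Stable α 1) {p q : ℤ × ℤ}
    (hp : p ∈ adom α) (hq : q ∈ adom α) : Relation.ReflTransGen (BondAdj α) p q := by
  by_contra hc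
  obtain ⟨u, hu, v, hv, huv⟩ := stable_one_iff.1 hα
    {x | x ∈ adom α ∧ Relation.ReflTransGen (BondAdj α) p x}
    (fun x hx => hx.1) ⟨p, hp, .refl⟩ ⟨q, hq, fun h => hc h.2⟩
  exact hv.2 ⟨hv.1, hu.2.tail huv⟩

/-! ## Producible and terminal assemblies -/

/-- The assemblies reached from the seed in finitely many attachment steps. -/
def FinProducible (S : RTAS) (α : Assembly) : Prop :=
  Relation.ReflTransGen (Attaches S) S.seed α

theorem FinProducible.stable {S : RTAS} {α : Assembly} (h : FinProducible S α) :
    Stable α S.temp := by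
  induction h with
  | refl => exact S.seed_stable
  | tail _ h _ =>
    obtain ⟨p, t, r, -, -, -, h⟩ := h
    exact h

theorem Attaches.mono {S : RTAS} {α β : Assembly} (h : Attaches S α β) {p : ℤ × ℤ}
    {a : Placement} (ha : α p = some a) : β p = some a := by
  obtain ⟨q, t, r, hq, -, rfl, -⟩ := h
  rwa [Function.update_of_ne]
  rintro rfl
  simp [hq] at ha

theorem FinProducible.mem_tiles {S : RTAS} {α : Assembly} (h : FinProducible S α) :
    ∀ p a, α p = some a → a.1 ∈ S.tiles := by
  induction h with
  | refl => exact S.seed_tiles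
  | tail _ h ih =>
    obtain ⟨q, t, r, hq, ht, rfl, -⟩ := h
    intro p a hp
    by_cases hpq : p = q
    · subst hpq
      simp only [Function.update_self, Option.some.injEq] at hp
      rw [← hp]
      exact ht
    · rw [Function.update_of_ne hpq] at hp
      exact ih p a hp

theorem finProducible_of_sequence {S : RTAS} {f : ℕ → Assembly} (h0 : f 0 = S.seed)
    (hs : ∀ n, f (n + 1) = f n ∨ Attaches S (f n) (f (n + 1))) (n : ℕ) :
    FinProducible S (f n) := by
  induction n with
  | zero => rw [h0]; exact .refl
  | succ n ih =>
    rcases hs n with h | h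
    · rwa [h]
    · exact ih.tail h

theorem sequence_mono {S : RTAS} {f : ℕ → Assembly}
    (hs : ∀ n, f (n + 1) = f n ∨ Attaches S (f n) (f (n + 1))) {m n : ℕ} (hmn : m ≤ n)
    {p : ℤ × ℤ} {a : Placement} (ha : f m p = some a) : f n p = some a := by
  induction hmn with
  | refl => exact ha
  | step _ ih =>
    rcases hs _ with h | h
    · rwa [h]
    · exact h.mono ih

theorem FinProducible.exists_sequence {S : RTAS} {α : Assembly} (h : FinProducible S α) :
    ∃ (f : ℕ → Assembly) (N : ℕ), f 0 = S.seed ∧ f N = α ∧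
      ∀ n, f (n + 1) = f n ∨ Attaches S (f n) (f (n + 1)) := by
  induction h with
  | refl => exact ⟨fun _ => S.seed, 0, rfl, rfl, fun _ => Or.inl rfl⟩
  | @tail β γ _ h ih =>
    obtain ⟨f, N, h0, hN, hs⟩ := ih
    refine ⟨fun n => if n ≤ N then f n else γ, N + 1, by simpa using h0, by simp, fun n => ?_⟩
    rcases lt_trichotomy n N with hn | rfl | hn
    · simpa [hn.le, Nat.succ_le_of_lt hn] using hs n
    · right; simpa [hN] using h
    · left; simp [hn.not_ge, (show ¬ n + 1 ≤ N by omega)]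

theorem Producible.mem_tiles {S : RTAS} {α : Assembly} (h : Producible S α) :
    ∀ p a, α p = some a → a.1 ∈ S.tiles := by
  obtain ⟨f, h0, hs, hα⟩ := h
  intro p a hp
  obtain ⟨n, hn⟩ := (hα p a).1 hp
  exact (finProducible_of_sequence h0 hs n).mem_tiles p a hn

theorem Producible.seed_le {S : RTAS} {α : Assembly} (h : Producible S α) {p : ℤ × ℤ}
    {a : Placement} (ha : S.seed p = some a) : α p = some a := by
  obtain ⟨f, h0, -, hα⟩ := h
  exact (hα p a).2 ⟨0, by rwa [h0]⟩

theorem Producible.reflTransGen_bondAdj {S : RTAS} (hS : S.temp = 1) {α : Assembly}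
    (h : Producible S α) {s p : ℤ × ℤ} (hs : s ∈ adom S.seed) (hp : p ∈ adom α) :
    Relation.ReflTransGen (BondAdj α) s p := by
  obtain ⟨f, h0, hf, hα⟩ := h
  obtain ⟨a, ha⟩ := Option.ne_none_iff_exists'.1 hp
  obtain ⟨b, hb⟩ := Option.ne_none_iff_exists'.1 hs
  obtain ⟨n, hn⟩ := (hα p a).1 ha
  have hsn : f n s = some b := sequence_mono hf (Nat.zero_le n) (by rwa [h0])
  have hst := (finProducible_of_sequence h0 hf n).stable
  rw [hS] at hst
  exact (reflTransGen_bondAdj_of_stable hst (p := s) (q := p) (by simp [adom, hsn])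
    (by simp [adom, hn])).lift id fun _ _ hxy => BondAdj.mono (fun x c hc => (hα x c).2 ⟨n, hc⟩) hxy

/-- At temperature 1, every finitely producible assembly extends to a terminal one. -/
theorem FinProducible.exists_terminal {S : RTAS} (hS : S.temp = 1) {α : Assembly}
    (h : FinProducible S α) :
    ∃ β, Terminal S β ∧ ∀ p a, α p = some a → β p = some a := by
  classical
  obtain ⟨f, N, h0, hN, hs⟩ := h.exists_sequence
  obtain ⟨e, he⟩ := exists_surjective_nat ((ℤ × ℤ) × Placement)
  let place (γ : Assembly) (x : (ℤ × ℤ) × Placement) : Assembly :=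
    if Attaches S γ (Function.update γ x.1 (some x.2)) then Function.update γ x.1 (some x.2) else γ
  let fair : ℕ → Assembly := fun n => Nat.rec α (fun k γ => place γ (e k.unpair.1)) n
  have hfair : ∀ n, fair (n + 1) = place (fair n) (e n.unpair.1) := fun n => rfl
  let g : ℕ → Assembly := fun n => if n ≤ N then f n else fair (n - N)
  have hgN : ∀ n, g (N + n) = fair n := by
    rintro (_ | n)
    · simp [g, hN, fair]
    · simp [g]
  have hg0 : g 0 = S.seed := by simp [g, h0]
  have hgs : ∀ n, g (n + 1) = g n ∨ Attaches S (g n) (g (n + 1)) := by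
    intro n
    rcases lt_or_ge n N with hn | hn
    · simpa [g, hn.le, Nat.succ_le_of_lt hn] using hs n
    · obtain ⟨k, rfl⟩ := Nat.exists_eq_add_of_le hn
      rw [add_assoc, hgN, hgN, hfair]
      simp only [place]
      split_ifs with hc
      · exact Or.inr hc
      · exact Or.inl rfl
  let β : Assembly := fun p => if hp : ∃ n, g n p ≠ none then g hp.choose p else none
  have hβ : ∀ p a, β p = some a ↔ ∃ n, g n p = some a := by
    intro p a
    by_cases hp : ∃ n, g n p ≠ none
    · have hβp : β p = g hp.choose p := dif_pos hp
      rw [hβp]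
      refine ⟨fun h => ⟨_, h⟩, fun ⟨n, hn⟩ => ?_⟩
      obtain ⟨b, hb⟩ := Option.ne_none_iff_exists'.1 hp.choose_spec
      have h1 := sequence_mono hgs (le_max_left n hp.choose) hn
      have h2 := sequence_mono hgs (le_max_right n hp.choose) hb
      rw [hb, ← h1, h2]
    · have hβp : β p = none := dif_neg hp
      rw [hβp]
      refine ⟨fun h => by simp at h, fun ⟨n, hn⟩ => absurd ⟨n, by simp [hn]⟩ hp⟩
  refine ⟨β, ⟨⟨g, hg0, hgs, hβ⟩, ?_⟩, fun p a ha => (hβ p a).2 ⟨N, ?_⟩⟩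
  · rintro γ ⟨p, t, r, hp, ht, rfl, hst⟩
    rw [hS, stable_one_iff] at hst
    obtain ⟨s, hs⟩ := S.seed_nonempty
    obtain ⟨b, hb⟩ := Option.ne_none_iff_exists'.1 hs
    have hsβ : β s = some b := (hβ s b).2 ⟨0, by rwa [hg0]⟩
    have hsp : s ≠ p := by rintro rfl; simp [hp] at hsβ
    obtain ⟨u, rfl, q, hq, hpq⟩ := hst {p} (by simp [adom]) ⟨p, rfl⟩
      ⟨s, by simp [adom, hsp, hsβ], hsp⟩
    obtain ⟨d, a, c, rfl, ha, hc, hbind⟩ := hpq.exists_step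
    have hne := hpq.ne
    rw [Function.update_of_ne hne.symm] at hc
    obtain ⟨n, hn⟩ := (hβ _ _).1 hc
    obtain ⟨k, hk⟩ := he (u, (t, r))
    have hn' : g (N + Nat.pair k n) (u + Side.step d) = some c :=
      sequence_mono hgs ((Nat.right_le_pair k n).trans (Nat.le_add_left _ _)) hn
    have hnone : ∀ m, g m u = none := by
      intro m
      by_contra hc
      obtain ⟨b, hb⟩ := Option.ne_none_iff_exists'.1 hc
      have := (hβ u b).2 ⟨m, hb⟩
      simp [hp] at this
    have hatt : Attaches S (g (N + Nat.pair k n))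
        (Function.update (g (N + Nat.pair k n)) u (some (t, r))) := by
      refine ⟨u, t, r, hnone _, ht, rfl, ?_⟩
      have hst := (finProducible_of_sequence hg0 hgs (N + Nat.pair k n)).stable
      rw [hS] at hst ⊢
      refine stable_update hst (hnone _) (q := u + Side.step d) ?_
      rw [Function.update_self] at ha
      rwa [BondAdj, bondStrength_step (a := a) (b := c) (by rw [Function.update_self, ha])
        (by rwa [Function.update_of_ne hne.symm])]
    have hnext := hnone (N + (Nat.pair k n + 1))
    rw [hgN, hfair, Nat.unpair_pair, hk] at hnext
    rw [hgN] at hatt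
    simp [place, hatt] at hnext
  · have : g N = α := by simp [g, hN]
    rwa [this]

/-! ## Legs: abstract non-backtracking chains of bound tiles -/

/-- Side `x` of tile type `t` can be bound, after a suitable reflection, to side `y` of `u`. -/
def Binds (t : TileType) (x : Side) (u : TileType) (y : Side) : Prop :=
  x.1 = y.1 ∧ 0 < glueBind (TileType.glueOn t x) (TileType.glueOn u y)

theorem Binds.symm {t u : TileType} {x y : Side} (h : Binds t x u y) : Binds u y t x :=
  ⟨h.1.symm, glueBind_comm (TileType.glueOn t x) _ ▸ h.2⟩

/-- `Leg T t x k u y`: starting from a tile of type `t`, leaving through its side `x`, a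
non-backtracking chain of `k` further tiles with types in `T` ends with a tile of type `u` entered
through its side `y`. -/
inductive Leg (T : Finset TileType) (t : TileType) (x : Side) : ℕ → TileType → Side → Prop
  | single {u : TileType} {y : Side} : Binds t x u y → u ∈ T → Leg T t x 1 u y
  | snoc {k : ℕ} {u v : TileType} {y z w : Side} : Leg T t x k u y → z ≠ y → Binds u z v w →
      v ∈ T → Leg T t x (k + 1) v w

namespace Leg

variable {T : Finset TileType} {t u v : TileType} {x y z w : Side} {k l : ℕ}

theorem mem (h : Leg T t x k u y) : u ∈ T := by
  cases h <;> assumption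

theorem trans (h : Leg T t x k u y) (hzy : z ≠ y) (h' : Leg T u z l v w) :
    Leg T t x (k + l) v w := by
  induction h' with
  | single hb hv => exact h.snoc hzy hb hv
  | snoc _ hne hb hv ih => exact ih.snoc hne hb hv

theorem symm (ht : t ∈ T) (h : Leg T t x k u y) : Leg T u y k t x := by
  induction h with
  | single hb _ => exact .single hb.symm ht
  | snoc hl hne hb _ ih =>
    rw [add_comm]
    exact (Leg.single hb.symm hl.mem).trans hne.symm ih

end Leg

/-! ## Monotone realization of legs -/

/-- The displacement from `p` to `q` along axis `a`, counted positively into the quadrant `σ`. -/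
def along (σ : Bool × Bool) (a : Bool) (p q : ℤ × ℤ) : ℤ :=
  if a then (if σ.2 then q.2 - p.2 else p.2 - q.2) else (if σ.1 then q.1 - p.1 else p.1 - q.1)

/-- `q` lies in the quadrant `σ` from `p`, strictly so along the axis `a`. -/
def InRegion (σ : Bool × Bool) (a : Bool) (p q : ℤ × ℤ) : Prop :=
  1 ≤ along σ a p q ∧ 0 ≤ along σ (!a) p q

theorem along_step (σ : Bool × Bool) (a b : Bool) (p q : ℤ × ℤ) :
    along σ a p (q + Side.step (sideInto σ b)) = along σ a p q + if a = b then 1 else 0 := by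
  obtain ⟨_ | _, _ | _⟩ := σ <;> cases a <;> cases b <;> simp [along, Side.step, sideInto] <;> ring

theorem along_step_left (σ : Bool × Bool) (a b : Bool) (p q : ℤ × ℤ) :
    along σ a (p + Side.step (sideInto σ b)) q = along σ a p q - if a = b then 1 else 0 := by
  obtain ⟨_ | _, _ | _⟩ := σ <;> cases a <;> cases b <;> simp [along, Side.step, sideInto] <;> ring

theorem along_self (σ : Bool × Bool) (a : Bool) (p : ℤ × ℤ) : along σ a p p = 0 := by
  simp [along]

theorem along_oppQuadrant (σ : Bool × Bool) (a : Bool) (p q : ℤ × ℤ) :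
    along (oppQuadrant σ) a p q = -along σ a p q := by
  obtain ⟨_ | _, _ | _⟩ := σ <;> cases a <;> simp [along, oppQuadrant]

theorem exists_reflection_onSide : ∀ (x y : Side) (σ : Bool × Bool), x ≠ y →
    ∃ r : Reflection, Reflection.onSide r x = sideInto σ x.1 ∧
      Reflection.onSide r y = Side.opp (sideInto σ y.1) := by
  decide

theorem FinProducible.attach {S : RTAS} (hS : S.temp = 1) {α : Assembly}
    (hα : FinProducible S α) {p : ℤ × ℤ} {t u : TileType} {r r' : Reflection} {x y d : Side}
    (hp : α p = some (t, r)) (hx : Reflection.onSide r x = d)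
    (hy : Reflection.onSide r' y = Side.opp d) (hb : Binds t x u y) (hu : u ∈ S.tiles)
    (hq : α (p + Side.step d) = none) :
    FinProducible S (Function.update α (p + Side.step d) (some (u, r'))) := by
  refine hα.tail ⟨_, u, r', hq, hu, rfl, ?_⟩
  have hst := hα.stable
  rw [hS] at hst ⊢
  have hne : p ≠ p + Side.step d := by
    intro h
    rw [← h, hp] at hq
    simp at hq
  refine stable_update hst hq (q := p) (BondAdj.symm ?_)
  rw [BondAdj, bondStrength_step (a := (t, r)) (b := (u, r'))
    (by rwa [Function.update_of_ne hne]) (by simp)]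
  simp only
  rw [← hx, Reflection.onSide_onSide, hx, ← hy, Reflection.onSide_onSide]
  exact hb.2

/-- A leg can be grown, monotonically within a prescribed quadrant, from any tile of a producible
assembly whose corresponding region is empty.  The last tile can be reflected so that any given
side other than the entry side points into the quadrant. -/
theorem Leg.grow {S : RTAS} (hS : S.temp = 1) {t u : TileType} {x y : Side} {k : ℕ}
    (h : Leg S.tiles t x k u y) {α : Assembly} (hα : FinProducible S α) {p : ℤ × ℤ}
    {r : Reflection} {σ : Bool × Bool} (hp : α p = some (t, r))
    (hx : Reflection.onSide r x = sideInto σ x.1)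
    (hempty : ∀ q, InRegion σ x.1 p q → α q = none) :
    ∀ z, z ≠ y → ∃ β p' r', FinProducible S β ∧ (∀ q a, α q = some a → β q = some a) ∧
      β p' = some (u, r') ∧ Reflection.onSide r' z = sideInto σ z.1 ∧
      Reflection.onSide r' y = Side.opp (sideInto σ y.1) ∧
      (∀ q, β q ≠ α q → InRegion σ x.1 p q ∧ (q = p' ∨ InRegion σ y.1 q p')) ∧
      InRegion σ y.1 p p' ∧ InRegion σ x.1 p p' ∧
      along σ false p p' + along σ true p p' = k := by
  induction h with
  | @single u y hb hu =>
    intro z hz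
    obtain ⟨r', hr1, hr2⟩ := exists_reflection_onSide z y σ hz
    have hreg : InRegion σ x.1 p (p + Side.step (sideInto σ x.1)) := by
      simp [InRegion, along_step, along_self]
    rw [← hb.1] at hr2 ⊢
    have hq := hempty _ hreg
    refine ⟨_, _, r', hα.attach hS hp hx hr2 hb hu hq, ?_, Function.update_self .., hr1, hr2,
      ?_, hreg, hreg, ?_⟩
    · intro q a ha
      rwa [Function.update_of_ne]
      rintro rfl
      simp [hq] at ha
    · intro q hne
      by_cases hqe : q = p + Side.step (sideInto σ x.1)
      · subst hqe
        exact ⟨hreg, Or.inl rfl⟩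
      · exact absurd (Function.update_of_ne hqe _ _) hne
    · cases x.1 <;> simp [along_step, along_self]
  | @snoc k u v y c w hl hc hb hv ih =>
    intro z hz
    obtain ⟨β, p', r', hβ, hle, hp', hrc, hry, hch, hyp, hxp, hsum⟩ := ih c hc
    obtain ⟨r'', hr1, hr2⟩ := exists_reflection_onSide z w σ hz
    rw [← hb.1] at hr2 ⊢
    have hreg : InRegion σ x.1 p (p' + Side.step (sideInto σ c.1)) := by
      revert hxp
      simp only [InRegion, along_step]
      rintro ⟨h1, h2⟩
      constructor <;> split_ifs <;> omega
    have hq : β (p' + Side.step (sideInto σ c.1)) = none := by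
      by_contra hne
      rw [← hempty _ hreg] at hne
      rcases (hch _ hne).2 with h | h
      · have := along_step σ c.1 c.1 p' p'
        rw [h, along_self] at this
        simp at this
      · simp only [InRegion, along_step_left, along_self] at h
        split_ifs at h <;> omega
    refine ⟨_, _, r'', hβ.attach hS hp' hrc hr2 hb hv hq, ?_, Function.update_self .., hr1, hr2,
      ?_, ?_, hreg, ?_⟩
    · intro q a ha
      rw [Function.update_of_ne]
      · exact hle q a ha
      · rintro rfl
        rw [hle _ _ ha] at hq
        simp at hq
    · intro q hne
      by_cases hqe : q = p' + Side.step (sideInto σ c.1)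
      · subst hqe
        exact ⟨hreg, Or.inl rfl⟩
      · rw [Function.update_of_ne hqe] at hne
        obtain ⟨h1, h2⟩ := hch q hne
        refine ⟨h1, Or.inr ?_⟩
        rcases h2 with rfl | h2
        · cases c.1 <;> simp [InRegion, along_step, along_self]
        · revert h2
          simp only [InRegion, along_step]
          cases c.1 <;> cases y.1 <;> simp <;> omega
    · revert hyp
      simp only [InRegion, along_step]
      cases c.1 <;> cases y.1 <;> simp <;> omega
    · simp only [along_step]
      push_cast
      rw [← hsum]
      cases c.1 <;> simp <;> ring

/-! ## Tripods -/

/-- A possibly empty leg of length `k` leads from side `x` of a tile of type `t` to a tile with type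
in `B`. -/
def Reaches (T B : Finset TileType) (t : TileType) (x : Side) (k : ℕ) : Prop :=
  (k = 0 ∧ t ∈ B) ∨ ∃ u y, Leg T t x k u y ∧ u ∈ B

theorem Reaches.grow {S : RTAS} (hS : S.temp = 1) {B : Finset TileType} {t : TileType} {x : Side}
    {k : ℕ} (h : Reaches S.tiles B t x k) {α : Assembly} (hα : FinProducible S α) {p : ℤ × ℤ}
    {r : Reflection} {σ : Bool × Bool} (hp : α p = some (t, r))
    (hx : Reflection.onSide r x = sideInto σ x.1)
    (hempty : ∀ q, InRegion σ x.1 p q → α q = none) :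
    ∃ β p' a, FinProducible S β ∧ (∀ q b, α q = some b → β q = some b) ∧
      β p' = some a ∧ a.1 ∈ B ∧ (∀ q, β q ≠ α q → InRegion σ x.1 p q) ∧
      0 ≤ along σ false p p' ∧ 0 ≤ along σ true p p' ∧
      along σ false p p' + along σ true p p' = k := by
  rcases h with ⟨rfl, ht⟩ | ⟨u, y, hl, hu⟩
  · exact ⟨α, p, _, hα, fun _ _ h => h, hp, ht, fun q h => absurd rfl h, by simp [along_self],
      by simp [along_self], by simp [along_self]⟩
  · obtain ⟨β, p', r', hβ, hle, hp', -, -, hch, -, hreg, hsum⟩ :=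
      hl.grow hS hα hp hx hempty (Side.opp y) (by simp [Side.opp, Prod.ext_iff])
    refine ⟨β, p', _, hβ, hle, hp', hu, fun q hq => (hch q hq).1, ?_, ?_, hsum⟩ <;>
    · revert hreg
      cases x.1 <;> simp only [InRegion, Bool.not_true, Bool.not_false] <;> omega

theorem exists_quadrant : ∀ (r : Reflection) (x y : Side), x ≠ y → ∃ σ : Bool × Bool,
    Reflection.onSide r x = sideInto σ x.1 ∧
      Reflection.onSide r y = sideInto (oppQuadrant σ) y.1 := by
  decide

theorem exists_transverse_quadrant : ∀ (x y e : Side), x ≠ y → x ≠ e → y ≠ e → ∃ z, z ≠ e ∧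
    ∀ (σ : Bool × Bool) (r : Reflection), Reflection.onSide r z = sideInto σ z.1 →
      Reflection.onSide r e = Side.opp (sideInto σ e.1) → ∃ σ' : Bool × Bool,
        Reflection.onSide r x = sideInto σ' x.1 ∧
          Reflection.onSide r y = sideInto (oppQuadrant σ') y.1 ∧
          σ' ≠ σ ∧ σ' ≠ oppQuadrant σ := by
  intro x y e hxy hxe hye
  refine ⟨if x.1 = e.1 then y else x, by split_ifs <;> exact Ne.symm (by tauto), ?_⟩
  refine fun σ r h1 h2 => ⟨(xor σ.1 x.1, xor σ.2 !x.1), ?_⟩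
  revert x y e σ r
  decide

theorem not_inRegion_of_transverse {σ σ' : Bool × Bool} (h1 : σ' ≠ σ) (h2 : σ' ≠ oppQuadrant σ)
    {x e : Side} {r : Reflection} (hxe : x ≠ e)
    (hx : Reflection.onSide r x = sideInto σ' x.1)
    (he : Reflection.onSide r e = Side.opp (sideInto σ e.1)) {p q : ℤ × ℤ}
    (hq : InRegion σ e.1 q p) : ¬ InRegion σ' x.1 p q := by
  have hne : sideInto σ' x.1 ≠ Side.opp (sideInto σ e.1) := by
    rw [← hx, ← he]
    exact (Reflection.onSide_injective r).ne hxe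
  revert hne hq h1 h2
  obtain ⟨a, b⟩ := σ
  obtain ⟨a', b'⟩ := σ'
  obtain ⟨i, -⟩ := x
  obtain ⟨j, -⟩ := e
  revert a b a' b' i j
  simp only [Bool.forall_bool]
  simp [InRegion, along, oppQuadrant, sideInto, Side.opp]
  omega

theorem not_inRegion_of_oppQuadrant {σ : Bool × Bool} {a b : Bool} {p q : ℤ × ℤ}
    (h : InRegion σ a p q) : ¬ InRegion (oppQuadrant σ) b p q := by
  revert h
  simp only [InRegion, along_oppQuadrant]
  cases a <;> cases b <;> simp <;> omega

/-- If two legs ending in `B` and one leg ending at the seed leave a tile through three distinct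
sides, then the two legs ending in `B` can be assembled simultaneously and monotonically into
opposite quadrants. -/
theorem exists_finProducible_tripod {S : RTAS} (hS : S.temp = 1) {p₀ : ℤ × ℤ} {a₀ : Placement}
    (hseed : adom S.seed = {p₀}) (ha₀ : S.seed p₀ = some a₀) {B : Finset TileType} {t : TileType}
    (ht : t ∈ S.tiles)
    {x y e : Side} (hxy : x ≠ y) (hxe : x ≠ e) (hye : y ≠ e) {k l : ℕ}
    (hx : Reaches S.tiles B t x k) (hy : Reaches S.tiles B t y l)
    (he : t = a₀.1 ∨ ∃ m z, Leg S.tiles t e m a₀.1 z) :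
    ∃ α p q a b, FinProducible S α ∧ α p = some a ∧ a.1 ∈ B ∧ α q = some b ∧ b.1 ∈ B ∧
      (k + l : ℤ) = |p.1 - q.1| + |p.2 - q.2| := by
  obtain ⟨α, p, r, σ, hα, hp, hrx, hry, hvx, hvy⟩ : ∃ (α : Assembly) (p : ℤ × ℤ) (r : Reflection)
      (σ : Bool × Bool), FinProducible S α ∧ α p = some (t, r) ∧
      Reflection.onSide r x = sideInto σ x.1 ∧
      Reflection.onSide r y = sideInto (oppQuadrant σ) y.1 ∧
      (∀ q, InRegion σ x.1 p q → α q = none) ∧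
      (∀ q, InRegion (oppQuadrant σ) y.1 p q → α q = none) := by
    have hseed' : ∀ q, q ≠ p₀ → S.seed q = none := by
      intro q hq
      by_contra hne
      exact hq (hseed.subset hne)
    have hirr : ∀ (σ : Bool × Bool) a, ¬ InRegion σ a p₀ p₀ := by
      simp [InRegion, along_self]
    rcases he with rfl | ⟨m, z, hl⟩
    · obtain ⟨σ, h1, h2⟩ := exists_quadrant a₀.2 x y hxy
      refine ⟨S.seed, p₀, a₀.2, σ, .refl, ha₀, h1, h2, ?_, ?_⟩ <;>
      · intro q hq
        refine hseed' q ?_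
        rintro rfl
        exact hirr _ _ hq
    · obtain ⟨c, hce, hc⟩ := exists_transverse_quadrant x y e hxy hxe hye
      obtain ⟨σ, hσ, -⟩ := exists_quadrant a₀.2 z (Side.opp z) (by simp [Side.opp, Prod.ext_iff])
      obtain ⟨α, p, r, hα, -, hp, hrc, hre, hch, hreg, -, -⟩ :=
        (hl.symm ht).grow hS .refl ha₀ hσ (fun q hq => hseed' q (by rintro rfl; exact hirr _ _ hq))
          c hce
      obtain ⟨σ', h1, h2, h3, h4⟩ := hc σ r hrc hre
      have hdom : ∀ q, α q ≠ none → q = p ∨ InRegion σ e.1 q p := by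
        intro q hq
        by_cases hqs : q = p₀
        · exact Or.inr (hqs ▸ hreg)
        · rw [← hseed' q hqs] at hq
          exact (hch q hq).2
      have h5 : oppQuadrant σ' ≠ σ := by
        rintro rfl
        exact h4 (by simp [oppQuadrant])
      have h6 : oppQuadrant σ' ≠ oppQuadrant σ := by
        simpa [oppQuadrant, Prod.ext_iff] using h3
      refine ⟨α, p, r, σ', hα, hp, h1, h2, ?_, ?_⟩
      · intro q hq
        by_contra hne
        rcases hdom q hne with rfl | h
        · simp [InRegion, along_self] at hq
        · exact not_inRegion_of_transverse h3 h4 hxe h1 hre h hq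
      · intro q hq
        by_contra hne
        rcases hdom q hne with rfl | h
        · simp [InRegion, along_self] at hq
        · exact not_inRegion_of_transverse h5 h6 hye h2 hre h hq
  obtain ⟨β, u, a, hβ, hle, hu, ha, hch, hu1, hu2, hus⟩ := hx.grow hS hα hp hrx hvx
  obtain ⟨γ, v, b, hγ, hle', hv, hb, -, hv1, hv2, hvs⟩ := hy.grow hS hβ (hle _ _ hp) hry (by
    intro q hq
    by_contra hne
    rw [← hvy q hq] at hne
    exact not_inRegion_of_oppQuadrant (hch q hne) hq)
  refine ⟨γ, u, v, a, b, hγ, hle' _ _ hu, ha, hv, hb, ?_⟩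
  rw [← hus, ← hvs]
  simp only [along_oppQuadrant] at hv1 hv2 ⊢
  rcases abs_cases (u.1 - v.1) with h | h <;> rcases abs_cases (u.2 - v.2) with h' | h' <;>
    obtain ⟨_ | _, _ | _⟩ := σ <;> simp [along] at hu1 hu2 hv1 hv2 ⊢ <;> omega

/-! ## Paths in the binding graph -/

/-- The type of the tile of `α` at `p` (junk if `p` is empty). -/
def tileTypeAt (α : Assembly) (p : ℤ × ℤ) : TileType := ((α p).getD default).1

/-- The side, in its own frame, with which the tile of `α` at `p` faces the adjacent point `q`. -/
def ownSide (α : Assembly) (p q : ℤ × ℤ) : Side :=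
  Reflection.onSide ((α p).getD default).2 (dirTo p q)

theorem BondAdj.binds {α : Assembly} {p q : ℤ × ℤ} (h : BondAdj α p q) :
    Binds (tileTypeAt α p) (ownSide α p q) (tileTypeAt α q) (ownSide α q p) := by
  obtain ⟨s, a, b, rfl, ha, hb, hpos⟩ := h.exists_step
  refine ⟨?_, ?_⟩
  · simp [ownSide, dirTo_step, dirTo_step_symm, Reflection.onSide, Side.opp]
  · simpa [tileTypeAt, ownSide, dirTo_step, dirTo_step_symm, ha, hb] using hpos

theorem BondAdj.ownSide_ne {α : Assembly} {p q q' : ℤ × ℤ} (h : BondAdj α p q)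
    (h' : BondAdj α p q') (hne : q ≠ q') : ownSide α p q ≠ ownSide α p q' := by
  obtain ⟨s, -, -, rfl, -⟩ := h.exists_step
  obtain ⟨s', -, -, rfl, -⟩ := h'.exists_step
  refine (Reflection.onSide_injective _).ne ?_
  rw [dirTo_step, dirTo_step]
  rintro rfl
  exact hne rfl

theorem BondAdj.tileTypeAt_mem {α : Assembly} {T : Finset TileType}
    (hT : ∀ p a, α p = some a → a.1 ∈ T) {p q : ℤ × ℤ} (h : BondAdj α p q) :
    tileTypeAt α p ∈ T := by
  obtain ⟨-, a, -, -, ha, -⟩ := h.exists_step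
  simpa [tileTypeAt, ha] using hT p a ha

theorem BondAdj.dist {α : Assembly} {p q : ℤ × ℤ} (h : BondAdj α p q) :
    |q.1 - p.1| + |q.2 - p.2| = 1 := by
  obtain ⟨⟨_ | _, _ | _⟩, -, -, rfl, -⟩ := h.exists_step <;> simp [Side.step]

/-- `w 0, …, w L` is a simple path in the binding graph of `α`. -/
structure BondPath (α : Assembly) (w : ℕ → ℤ × ℤ) (L : ℕ) : Prop where
  adj : ∀ k < L, BondAdj α (w k) (w (k + 1))
  inj : ∀ i ≤ L, ∀ j ≤ L, w i = w j → i = j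

theorem exists_bondPath {α : Assembly} {p q : ℤ × ℤ} (h : Relation.ReflTransGen (BondAdj α) p q) :
    ∃ w L, BondPath α w L ∧ w 0 = p ∧ w L = q := by
  classical
  let G : SimpleGraph (ℤ × ℤ) := ⟨BondAdj α, ⟨fun _ _ => BondAdj.symm⟩, ⟨fun _ h => h.ne rfl⟩⟩
  have hr : G.Reachable p q := (SimpleGraph.reachable_iff_reflTransGen p q).2 h
  obtain ⟨c, hc⟩ := hr.exists_isPath
  exact ⟨c.getVert, c.length, ⟨fun k hk => c.adj_getVert_succ hk,
    fun i hi j hj hij => hc.getVert_injOn hi hj hij⟩, c.getVert_zero, c.getVert_length⟩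

namespace BondPath

variable {α : Assembly} {w : ℕ → ℤ × ℤ} {L : ℕ}

theorem reverse (hw : BondPath α w L) : BondPath α (fun k => w (L - k)) L where
  adj k hk := by
    have h := (hw.adj (L - (k + 1)) (by omega)).symm
    rwa [show L - (k + 1) + 1 = L - k by omega] at h
  inj i hi j hj hij := by
    have := hw.inj (L - i) (by omega) (L - j) (by omega) hij
    omega

theorem dist_le (hw : BondPath α w L) : ∀ k ≤ L,
    |(w k).1 - (w 0).1| + |(w k).2 - (w 0).2| ≤ k := by
  intro k
  induction k with
  | zero => simp
  | succ k ih =>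
    intro hk
    have h1 := ih (by omega)
    have h2 := (hw.adj k hk).dist
    have h3 := abs_sub_le (w (k + 1)).1 (w k).1 (w 0).1
    have h4 := abs_sub_le (w (k + 1)).2 (w k).2 (w 0).2
    push_cast
    linarith

theorem leg (hw : BondPath α w L) {T : Finset TileType} (hT : ∀ p a, α p = some a → a.1 ∈ T)
    {i j : ℕ} (hij : i < j) (hj : j ≤ L) :
    Leg T (tileTypeAt α (w i)) (ownSide α (w i) (w (i + 1))) (j - i) (tileTypeAt α (w j))
      (ownSide α (w j) (w (j - 1))) := by
  induction j, hij using Nat.le_induction with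
  | base =>
    have h := hw.adj i hj
    simpa using Leg.single h.binds (h.symm.tileTypeAt_mem hT)
  | succ j hij ih =>
    have hprev := hw.adj (j - 1) (by omega)
    rw [Nat.sub_add_cancel (by omega)] at hprev
    have h := hw.adj j hj
    rw [Nat.sub_add_comm (by omega)]
    refine (ih (by omega)).snoc (h.ownSide_ne hprev.symm fun he => ?_) h.binds
      (h.symm.tileTypeAt_mem hT)
    have := hw.inj _ (by omega) _ (by omega) he
    omega

theorem leg_symm (hw : BondPath α w L) {T : Finset TileType}
    (hT : ∀ p a, α p = some a → a.1 ∈ T) {i j : ℕ} (hij : i < j) (hj : j ≤ L) :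
    Leg T (tileTypeAt α (w j)) (ownSide α (w j) (w (j - 1))) (j - i) (tileTypeAt α (w i))
      (ownSide α (w i) (w (i + 1))) :=
  (hw.leg hT hij hj).symm ((hw.adj i (by omega)).tileTypeAt_mem hT)

theorem ownSide_succ_ne_pred (hw : BondPath α w L) {j : ℕ} (h0 : 0 < j) (hj : j < L) :
    ownSide α (w j) (w (j + 1)) ≠ ownSide α (w j) (w (j - 1)) := by
  have hprev := hw.adj (j - 1) (by omega)
  rw [Nat.sub_add_cancel h0] at hprev
  refine (hw.adj j hj).ownSide_ne hprev.symm fun he => ?_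
  have := hw.inj _ (by omega) _ (by omega) he
  omega

end BondPath

theorem exists_side_ne : ∀ x y : Side, ∃ e : Side, e ≠ x ∧ e ≠ y := by
  decide

/-- A third side of some tile of a simple path leads to any tile connected to the path. -/
theorem BondPath.exists_arm {α : Assembly} {w : ℕ → ℤ × ℤ} {L : ℕ} (hw : BondPath α w L)
    {T : Finset TileType} (hT : ∀ p a, α p = some a → a.1 ∈ T) {s : ℤ × ℤ}
    (hs : Relation.ReflTransGen (BondAdj α) (w 0) s) :
    ∃ f ≤ L, ∃ e, (0 < f → e ≠ ownSide α (w f) (w (f - 1))) ∧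
      (f < L → e ≠ ownSide α (w f) (w (f + 1))) ∧
      (tileTypeAt α (w f) = tileTypeAt α s ∨
        ∃ m z, Leg T (tileTypeAt α (w f)) e m (tileTypeAt α s) z) := by
  classical
  obtain ⟨g, M, hg, hg0, hgM⟩ := exists_bondPath hs
  let P : ℕ → Prop := fun κ => ∃ k ≤ L, w k = g κ
  have hP : P (Nat.findGreatest P M) :=
    Nat.findGreatest_spec (Nat.zero_le M) ⟨0, Nat.zero_le L, hg0.symm⟩
  have hlast : ∀ κ, Nat.findGreatest P M < κ → κ ≤ M → ¬ P κ := fun κ =>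
    Nat.findGreatest_is_greatest
  have hle := Nat.findGreatest_le (P := P) M
  generalize Nat.findGreatest P M = κ at hP hlast hle
  obtain ⟨f, hf, hfκ⟩ := hP
  refine ⟨f, hf, ?_⟩
  rcases hle.eq_or_lt with rfl | hlt
  · obtain ⟨e, h1, h2⟩ := exists_side_ne (ownSide α (w f) (w (f - 1))) (ownSide α (w f) (w (f + 1)))
    exact ⟨e, fun _ => h1, fun _ => h2, Or.inl (by rw [hfκ, hgM])⟩
  · have hκ := hg.adj κ hlt
    rw [← hfκ] at hκ
    have hoff : ∀ k ≤ L, g (κ + 1) ≠ w k := fun k hk he =>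
      hlast _ (Nat.lt_succ_self κ) hlt ⟨k, hk, he.symm⟩
    refine ⟨ownSide α (w f) (g (κ + 1)), fun h0 => ?_, fun hfL => ?_, Or.inr
      ⟨M - κ, ownSide α s (g (M - 1)), ?_⟩⟩
    · have hprev := hw.adj (f - 1) (by omega)
      rw [Nat.sub_add_cancel h0] at hprev
      exact hκ.ownSide_ne hprev.symm (hoff _ (by omega))
    · exact hκ.ownSide_ne (hw.adj f hfL) (hoff _ hfL)
    · have := hg.leg hT hlt le_rfl
      rwa [hgM, ← hfκ] at this

/-- In a simple path of length at least `2 * n - 2` over fewer than `n` tile types, the repetition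
of a type before the tile `w f` allows the legs leaving `w f` to be lengthened. -/
theorem BondPath.exists_long_legs {α : Assembly} {w : ℕ → ℤ × ℤ} {L : ℕ} (hw : BondPath α w L)
    {T B : Finset TileType} (hT : ∀ p a, α p = some a → a.1 ∈ T)
    (h0 : tileTypeAt α (w 0) ∈ B) (hL : tileTypeAt α (w L) ∈ B) {n f : ℕ} (hn : 2 ≤ n)
    (hcard : T.card < n) (hnL : 2 * n - 2 ≤ L) (hfn : n - 1 ≤ f) (hf : f ≤ L) {e : Side}
    (hel : 0 < f → e ≠ ownSide α (w f) (w (f - 1)))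
    (her : f < L → e ≠ ownSide α (w f) (w (f + 1))) :
    ∃ x y k l, x ≠ y ∧ x ≠ e ∧ y ≠ e ∧ Reaches T B (tileTypeAt α (w f)) x k ∧
      Reaches T B (tileTypeAt α (w f)) y l ∧ 2 * n - 2 < k + l := by
  have hmem : ∀ k ∈ Finset.range n, tileTypeAt α (w k) ∈ T := fun k hk =>
    (hw.adj k (by rw [Finset.mem_range] at hk; omega)).tileTypeAt_mem hT
  obtain ⟨i, j, hij, hjn, hty⟩ : ∃ i j, i < j ∧ j < n ∧
      tileTypeAt α (w i) = tileTypeAt α (w j) := by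
    obtain ⟨i, hi, j, hj, hne, hty⟩ :=
      Finset.exists_ne_map_eq_of_card_lt_of_maps_to (by simpa using hcard) hmem
    rw [Finset.mem_range] at hi hj
    rcases hne.lt_or_gt with h | h
    exacts [⟨i, j, h, hj, hty⟩, ⟨j, i, h, hi, hty.symm⟩]
  obtain ⟨y, hyl, hye, hy⟩ : ∃ y, ownSide α (w f) (w (f - 1)) ≠ y ∧ y ≠ e ∧
      Reaches T B (tileTypeAt α (w f)) y (L - f) := by
    rcases hf.eq_or_lt with rfl | hfL
    · obtain ⟨y, h1, h2⟩ := exists_side_ne (ownSide α (w f) (w (f - 1))) e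
      exact ⟨y, h1.symm, h2, Or.inl ⟨Nat.sub_self f, hL⟩⟩
    · exact ⟨_, (hw.ownSide_succ_ne_pred (by omega) hfL).symm, (her hfL).symm,
        Or.inr ⟨_, _, hw.leg hT hfL le_rfl, hL⟩⟩
  have hleft := hw.leg_symm hT (show i < f by omega) hf
  rw [hty] at hleft
  by_cases hc : ownSide α (w i) (w (i + 1)) = ownSide α (w j) (w (j - 1))
  · have hne := hw.ownSide_succ_ne_pred (show 0 < j by omega) (by omega)
    rw [← hc] at hne
    exact ⟨_, y, _, _, hyl, (hel (by omega)).symm, hye,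
      Or.inr ⟨_, _, hleft.trans hne (hw.leg hT (show j < L by omega) le_rfl), hL⟩, hy, by omega⟩
  · exact ⟨_, y, _, _, hyl, (hel (by omega)).symm, hye,
      Or.inr ⟨_, _, hleft.trans (Ne.symm hc) (hw.leg_symm hT (show 0 < j by omega) (by omega)), h0⟩,
      hy, by omega⟩

/-! ## Squares -/

theorem StrictlySelfAssembles.weaklySelfAssembles {S : RTAS} {X : Set (ℤ × ℤ)}
    (h : StrictlySelfAssembles S X) : WeaklySelfAssembles S X := by
  refine ⟨S.tiles, subset_rfl, fun α hα => ?_⟩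
  obtain ⟨r, v, hX⟩ := h α hα
  refine ⟨r, v, ?_⟩
  rw [← hX]
  ext p
  simp only [transform, adom, Set.mem_ofPred_eq]
  constructor
  · rintro ⟨a, ha, -⟩
    simp [ha]
  · intro hp
    obtain ⟨a, ha⟩ := Option.ne_none_iff_exists'.1 hp
    refine ⟨a, ha, ?_⟩
    obtain ⟨b, hb, rfl⟩ := Option.map_eq_some_iff.1 ha
    exact hα.1.mem_tiles _ b hb

theorem Reflection.onPoint_onPoint (r : Reflection) (p : ℤ × ℤ) :
    Reflection.onPoint r (Reflection.onPoint r p) = p := by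
  obtain ⟨_ | _, _ | _⟩ := r <;> simp [Reflection.onPoint]

theorem Reflection.abs_onPoint_sub (r : Reflection) (p q : ℤ × ℤ) :
    |(Reflection.onPoint r p).1 - (Reflection.onPoint r q).1| = |p.1 - q.1| ∧
      |(Reflection.onPoint r p).2 - (Reflection.onPoint r q).2| = |p.2 - q.2| := by
  obtain ⟨_ | _, _ | _⟩ := r <;> simp [Reflection.onPoint, abs_sub_comm, neg_add_eq_sub]

theorem exists_transform_eq_some_iff {α : Assembly} {r : Reflection} {v p : ℤ × ℤ}
    {B : Finset TileType} : (∃ a, transform α r v p = some a ∧ a.1 ∈ B) ↔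
      ∃ a, α (Reflection.onPoint r (p - v)) = some a ∧ a.1 ∈ B := by
  rcases h : α (Reflection.onPoint r (p - v)) with _ | a <;> simp [transform, h]

/-- At temperature 1, a singly seeded system that weakly self-assembles an `n × n` square has at
least `n` tile types. -/
theorem WeaklySelfAssembles.le_card_tiles {S : RTAS} (hS : S.temp = 1) (hseed : SinglySeeded S)
    {n : ℕ} (h : WeaklySelfAssembles S (squareShape n)) : n ≤ S.tiles.card := by
  by_contra! hcard
  obtain ⟨B, -, hB⟩ := h
  obtain ⟨p₀, hp₀⟩ := hseed
  obtain ⟨a₀, ha₀⟩ := Option.ne_none_iff_exists'.1 (hp₀.symm.subset rfl : p₀ ∈ adom S.seed)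
  have hn : 2 ≤ n := by
    have := Finset.card_pos.2 ⟨_, S.seed_tiles _ _ ha₀⟩
    omega
  obtain ⟨α, hα, -⟩ := FinProducible.exists_terminal hS (α := S.seed) .refl
  have hT := hα.1.mem_tiles
  have hs : tileTypeAt α p₀ = a₀.1 := by
    simp [tileTypeAt, hα.1.seed_le ha₀]
  have hconn : ∀ p ∈ adom α, Relation.ReflTransGen (BondAdj α) p₀ p := fun p =>
    hα.1.reflTransGen_bondAdj hS (hp₀.symm.subset rfl)
  obtain ⟨z, z', hz, hz', hzz'⟩ : ∃ z z' : ℤ × ℤ, (∃ a, α z = some a ∧ a.1 ∈ B) ∧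
      (∃ a, α z' = some a ∧ a.1 ∈ B) ∧ |z'.1 - z.1| + |z'.2 - z.2| = 2 * n - 2 := by
    obtain ⟨r, v, hr⟩ := hB α hα
    have hmem : ∀ p ∈ squareShape n, ∃ a, α (Reflection.onPoint r (p - v)) = some a ∧ a.1 ∈ B :=
      fun p hp => exists_transform_eq_some_iff.1 (hr.superset hp)
    refine ⟨_, _, hmem (0, 0) ?_, hmem ((n : ℤ) - 1, (n : ℤ) - 1) ?_, ?_⟩
    · simp [squareShape, rectShape]
      omega
    · simp [squareShape, rectShape]
      omega
    · rw [(r.abs_onPoint_sub _ _).1, (r.abs_onPoint_sub _ _).2]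
      simp only [Prod.fst_sub, Prod.snd_sub, sub_sub_sub_cancel_right, sub_zero]
      rw [abs_of_nonneg (by omega)]
      ring
  obtain ⟨a, hza, ha⟩ := hz
  obtain ⟨b, hzb, hb⟩ := hz'
  have hsymm : Std.Symm (BondAdj α) := ⟨fun _ _ => BondAdj.symm⟩
  have hz₀ := Relation.ReflTransGen.stdSymm.symm _ _ (hconn z (by simp [adom, hza]))
  obtain ⟨w, L, hw, hw0, hwL⟩ := exists_bondPath
    (hz₀.trans (hconn z' (by simp [adom, hzb])))
  have hnL : 2 * n - 2 ≤ L := by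
    have := hw.dist_le L le_rfl
    rw [hw0, hwL, hzz'] at this
    omega
  have hB0 : tileTypeAt α (w 0) ∈ B := by simpa [tileTypeAt, hw0, hza] using ha
  have hBL : tileTypeAt α (w L) ∈ B := by simpa [tileTypeAt, hwL, hzb] using hb
  obtain ⟨f, hf, e, hel, her, harm⟩ := hw.exists_arm hT (hw0.symm ▸ hz₀)
  rw [hs] at harm
  obtain ⟨x, y, k, l, hxy, hxe, hye, hx, hy, hkl⟩ : ∃ x y k l, x ≠ y ∧ x ≠ e ∧ y ≠ e ∧
      Reaches S.tiles B (tileTypeAt α (w f)) x k ∧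
      Reaches S.tiles B (tileTypeAt α (w f)) y l ∧ 2 * n - 2 < k + l := by
    rcases le_or_gt (n - 1) f with hfn | hfn
    · exact hw.exists_long_legs hT hB0 hBL hn hcard hnL hfn hf hel her
    · have := hw.reverse.exists_long_legs hT (B := B) (by simpa using hBL) (by simpa using hB0)
        hn hcard hnL (f := L - f) (by omega) (by omega) (e := e)
      simp only [Nat.sub_sub_self hf] at this
      refine this (fun h => ?_) (fun h => ?_)
      · rw [show L - (L - f - 1) = f + 1 by omega]
        exact her (by omega)
      · rw [show L - (L - f + 1) = f - 1 by omega]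
        exact hel (by omega)
  have htf : tileTypeAt α (w f) ∈ S.tiles := by
    rcases hf.eq_or_lt with rfl | hfL
    · have h := hw.adj (f - 1) (by omega)
      rw [Nat.sub_add_cancel (by omega)] at h
      exact h.symm.tileTypeAt_mem hT
    · exact (hw.adj f hfL).tileTypeAt_mem hT
  obtain ⟨γ, p, q, c, d, hγ, hp, hc, hq, hd, hpq⟩ :=
    exists_finProducible_tripod hS hp₀ ha₀ htf hxy hxe hye hx hy harm
  obtain ⟨β, hβ, hle⟩ := hγ.exists_terminal hS
  obtain ⟨r, v, hr⟩ := hB β hβ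
  have hsq : ∀ p a, β p = some a → a.1 ∈ B → Reflection.onPoint r p + v ∈ squareShape n := by
    intro p a hpa ha
    refine hr.subset (exists_transform_eq_some_iff.2 ⟨a, ?_, ha⟩)
    rwa [add_sub_cancel_right, Reflection.onPoint_onPoint]
  obtain ⟨h1, h2, h3, h4⟩ := hsq p c (hle _ _ hp) hc
  obtain ⟨h5, h6, h7, h8⟩ := hsq q d (hle _ _ hq) hd
  rw [← (r.abs_onPoint_sub p q).1, ← (r.abs_onPoint_sub p q).2] at hpq
  simp only [Prod.fst_add, Prod.snd_add] at h1 h2 h3 h4 h5 h6 h7 h8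
  have h9 := abs_le.2 ⟨show -((n : ℤ) - 1) ≤ (r.onPoint p).1 - (r.onPoint q).1 by omega,
    by omega⟩
  have h10 := abs_le.2 ⟨show -((n : ℤ) - 1) ≤ (r.onPoint p).2 - (r.onPoint q).2 by omega,
    by omega⟩
  omega

/-- For every odd `n ∈ ℤ⁺`, no singly seeded temperature-1 RTAM system
with fewer than `n` tile types weakly (or strictly) self-assembles an `n × n` square. -/
theorem rtam_odd_square_lower_bound
    (n : ℕ) (hn : Odd n) :
    ¬ ∃ Sys : RTAS, Sys.temp = 1 ∧ Sys.tiles.card < n ∧ SinglySeeded Sys ∧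
      (WeaklySelfAssembles Sys (squareShape n) ∨
        StrictlySelfAssembles Sys (squareShape n)) := by
  rintro ⟨S, hS, hcard, hseed, h⟩
  have hw : WeaklySelfAssembles S (squareShape n) :=
    h.elim id StrictlySelfAssembles.weaklySelfAssembles
  exact (hw.le_card_tiles hS hseed).not_gt hcard
end

section
/- Let S ⊆ ℤ² be a finite connected shape, and let S² be the 2-scaling of S. Then there exists a mismatch-free RTAM system 𝒯 = (T, σ, 2) at temperature 2 with |dom σ| = 1 in which S² strictly self-assembles. -/
namespace RTAM

/-- A unit direction: the first component tells whether it is vertical, the second one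
whether it is positive. -/
abbrev Dir : Type := Bool × Bool

/-- The unit vector of a direction. -/
def vec (d : Dir) : ℤ × ℤ :=
  if d.1 then (0, if d.2 then 1 else -1) else (if d.2 then 1 else -1, 0)

/-- The opposite direction. -/
def neg (d : Dir) : Dir := (d.1, !d.2)

/-- The action of a reflection on directions. -/
def act (r : Reflection) (d : Dir) : Dir := (d.1, xor (if d.1 then r.2 else r.1) d.2)

@[simp] lemma neg_neg' (d : Dir) : neg (neg d) = d := by simp [neg]

@[simp] lemma neg_fst (d : Dir) : (neg d).1 = d.1 := rfl

@[simp] lemma act_fst (r : Reflection) (d : Dir) : (act r d).1 = d.1 := rfl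

lemma act_eq_or_neg (r : Reflection) (d : Dir) : act r d = d ∨ act r d = neg d := by
  rcases r with ⟨_ | _, _ | _⟩ <;> rcases d with ⟨_ | _, _ | _⟩ <;> simp [act, neg]

lemma act_eq_of_axis {r : Reflection} {d e : Dir} (h : act r d = d) (he : e.1 = d.1) :
    act r e = e := by
  revert h he
  rcases r with ⟨_ | _, _ | _⟩ <;> rcases d with ⟨_ | _, _ | _⟩ <;>
    rcases e with ⟨_ | _, _ | _⟩ <;> simp [act]

lemma eq_or_neg_of_axis {d e : Dir} (h : e.1 = d.1) : e = d ∨ e = neg d := by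
  revert h
  rcases d with ⟨_ | _, _ | _⟩ <;> rcases e with ⟨_ | _, _ | _⟩ <;> simp [neg]

lemma neg_ne (d : Dir) : neg d ≠ d := by
  rcases d with ⟨_ | _, _ | _⟩ <;> simp [neg]

lemma vec_neg (d : Dir) : vec (neg d) = -vec d := by
  rcases d with ⟨_ | _, _ | _⟩ <;> simp [neg, vec]

@[simp] lemma add_vec_neg (p : ℤ × ℤ) (d : Dir) : p + vec d + vec (neg d) = p := by
  rw [vec_neg]; simp

lemma vec_injective : Function.Injective vec := by
  rintro ⟨_ | _, _ | _⟩ ⟨_ | _, _ | _⟩ <;> simp [vec]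

lemma vec_ne_zero (d : Dir) : vec d ≠ 0 := by
  rcases d with ⟨_ | _, _ | _⟩ <;> simp [vec, Prod.ext_iff]

/-- The tile type with prescribed glues. -/
def tileOf (g : Dir → Glue) : TileType :=
  (g (true, true), g (false, true), g (true, false), g (false, false))

lemma facingGlue_tileOf (g : Dir → Glue) (r : Reflection) (p : ℤ × ℤ) (d : Dir) :
    facingGlue (tileOf g, r) p (p + vec d) = g (act r d) := by
  obtain ⟨x, y⟩ := p
  rcases d with ⟨_ | _, _ | _⟩ <;> rcases r with ⟨_ | _, _ | _⟩ <;>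
    simp [facingGlue, vec, tileOf, act, TileType.reflect, TileType.east, TileType.west,
      TileType.north, TileType.south] <;> intros <;> omega

lemma exists_vec_of_facingGlue {pl : Placement} {p q : ℤ × ℤ} (h : facingGlue pl p q ≠ none) :
    ∃ d, q = p + vec d := by
  unfold facingGlue at h
  split_ifs at h with h1 h2 h3 h4
  · exact ⟨(false, true), by simp [h1, vec, Prod.ext_iff]⟩
  · exact ⟨(false, false), by simp [h2, vec, Prod.ext_iff, sub_eq_add_neg]⟩
  · exact ⟨(true, true), by simp [h3, vec, Prod.ext_iff]⟩
  · exact ⟨(true, false), by simp [h4, vec, Prod.ext_iff, sub_eq_add_neg]⟩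
  · exact absurd rfl h

lemma exists_vec_of_gridAdj {p q : ℤ × ℤ} (h : GridAdj p q) : ∃ d, q = p + vec d := by
  obtain ⟨x, y⟩ := p
  obtain ⟨x', y'⟩ := q
  simp only [GridAdj] at h
  have : (x' = x + 1 ∧ y' = y) ∨ (x' = x - 1 ∧ y' = y) ∨ (x' = x ∧ y' = y + 1) ∨
      (x' = x ∧ y' = y - 1) := by omega
  rcases this with ⟨rfl, rfl⟩ | ⟨rfl, rfl⟩ | ⟨rfl, rfl⟩ | ⟨rfl, rfl⟩
  · exact ⟨(false, true), by simp [vec]⟩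
  · exact ⟨(false, false), by simp [vec, sub_eq_add_neg]⟩
  · exact ⟨(true, true), by simp [vec]⟩
  · exact ⟨(true, false), by simp [vec, sub_eq_add_neg]⟩

lemma glueBind_comm (g h : Glue) : glueBind g h = glueBind h g := by
  rcases g with _ | ⟨a, s⟩ <;> rcases h with _ | ⟨b, t⟩ <;> simp only [glueBind]
  have : (b = -a ∧ t = s) ↔ (a = -b ∧ s = t) := by omega
  by_cases h : b = -a ∧ t = s
  · rw [if_pos h, if_pos (this.1 h), h.2]
  · rw [if_neg h, if_neg (fun h' => h (this.2 h'))]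

lemma bondStrength_comm (α : Assembly) (p q : ℤ × ℤ) :
    bondStrength α p q = bondStrength α q p := by
  unfold bondStrength
  rcases α p with _ | a <;> rcases α q with _ | b <;> simp [glueBind_comm]

lemma exists_vec_of_bond {α : Assembly} {p q : ℤ × ℤ} (h : bondStrength α p q ≠ 0) :
    ∃ d, q = p + vec d := by
  unfold bondStrength at h
  rcases hp : α p with _ | a <;> rcases hq : α q with _ | b <;> simp only [hp, hq] at h
  · exact absurd rfl h
  · exact absurd rfl h
  · exact absurd rfl h
  · refine exists_vec_of_facingGlue (pl := a) fun h0 => h ?_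
    rw [h0]; rfl

lemma bondStrength_congr {α β : Assembly} {p q : ℤ × ℤ} (hp : α p = β p) (hq : α q = β q) :
    bondStrength α p q = bondStrength β p q := by
  unfold bondStrength; rw [hp, hq]

lemma bondStrength_of_left {α : Assembly} {p q : ℤ × ℤ} (h : α p = none) :
    bondStrength α p q = 0 := by
  unfold bondStrength; rw [h]

lemma bondStrength_of_right {α : Assembly} {p q : ℤ × ℤ} (h : α q = none) :
    bondStrength α p q = 0 := by
  rw [bondStrength_comm, bondStrength_of_left h]

lemma adom_update (α : Assembly) (p : ℤ × ℤ) (pl : Placement) :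
    adom (Function.update α p (some pl)) = insert p (adom α) := by
  ext q
  by_cases h : q = p
  · subst h; simp [adom]
  · simp [adom, h]

/-- The total strength with which the tile at `p` binds to its neighbours. -/
def totalBond (α : Assembly) (p : ℤ × ℤ) : ℕ := ∑ d : Dir, bondStrength α p (p + vec d)

/-- A stable assembly binds each of its tiles strongly enough. -/
lemma le_totalBond_of_stable {α : Assembly} {τ : ℕ} {p q : ℤ × ℤ} (h : Stable α τ)
    (hp : p ∈ adom α) (hq : q ∈ adom α) (hqp : q ≠ p) : τ ≤ totalBond α p := by
  obtain ⟨E, hE, hs⟩ := h {p} (by simpa using hp) ⟨p, rfl⟩ ⟨q, hq, hqp⟩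
  refine hs.trans ?_
  have hinj : Function.Injective fun d : Dir => (p, p + vec d) := by
    intro d e hde
    simp only [Prod.mk.injEq, add_right_inj, true_and] at hde
    exact vec_injective hde
  have : totalBond α p = ∑ e ∈ Finset.univ.image (fun d : Dir => (p, p + vec d)),
      bondStrength α e.1 e.2 := by
    rw [Finset.sum_image (fun _ _ _ _ h => hinj h)]; rfl
  rw [this]
  refine Finset.sum_le_sum_of_ne_zero fun e he hne => ?_
  obtain ⟨h1, -⟩ := hE e he
  obtain ⟨d, hd⟩ := exists_vec_of_bond hne
  have h1 : e.1 = p := h1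
  simp only [Finset.mem_image, Finset.mem_univ, true_and]
  exact ⟨d, by rw [← h1, ← hd]⟩

/-- Adding a strongly bound tile preserves stability. -/
lemma stable_update {α : Assembly} {τ : ℕ} {p : ℤ × ℤ} {pl : Placement} (hα : Stable α τ)
    (hp : α p = none) (h : τ ≤ totalBond (Function.update α p (some pl)) p) :
    Stable (Function.update α p (some pl)) τ := by
  set β := Function.update α p (some pl) with hβ
  have hdom : adom β = insert p (adom α) := adom_update α p pl
  have hpα : p ∉ adom α := by simp [adom, hp]
  have hoff : ∀ q ∈ adom α, β q = α q := fun q hq =>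
    Function.update_of_ne (fun hqp : q = p => hpα (hqp ▸ hq)) _ _
  have hvec : ∀ d, p + vec d ≠ p := fun d => by simpa using vec_ne_zero d
  have hinj : Function.Injective fun d : Dir => (p, p + vec d) := by
    intro d e hde
    simp only [Prod.mk.injEq, add_right_inj, true_and] at hde
    exact vec_injective hde
  have hinj' : Function.Injective fun d : Dir => (p + vec d, p) := by
    intro d e hde
    simp only [Prod.mk.injEq, add_right_inj, and_true] at hde
    exact vec_injective hde
  classical
  have hfil : ∑ d ∈ Finset.univ.filter (fun d : Dir => p + vec d ∈ adom α),
      bondStrength β p (p + vec d) = totalBond β p := by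
    refine Finset.sum_filter_of_ne fun d _ hd => ?_
    by_contra hne
    refine hd (bondStrength_of_right ?_)
    rw [hβ, Function.update_of_ne (hvec d)]
    by_contra h'
    exact hne h'
  intro A hA hAne hAc
  have key : ∀ A' ⊆ adom α, A'.Nonempty → (adom α \ A').Nonempty → A' ⊆ A →
      adom α \ A' ⊆ adom β \ A → ∃ E : Finset ((ℤ × ℤ) × (ℤ × ℤ)),
      (∀ e ∈ E, e.1 ∈ A ∧ e.2 ∈ adom β \ A) ∧ τ ≤ ∑ e ∈ E, bondStrength β e.1 e.2 := by
    intro A' h1 h2 h3 h4 h5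
    obtain ⟨E, hE, hs⟩ := hα A' h1 h2 h3
    refine ⟨E, fun e he => ⟨h4 (hE e he).1, h5 (hE e he).2⟩, hs.trans (le_of_eq ?_)⟩
    refine Finset.sum_congr rfl fun e he => ?_
    exact bondStrength_congr (hoff _ (h1 (hE e he).1)).symm (hoff _ (hE e he).2.1).symm
  by_cases hpA : p ∈ A
  · by_cases hA1 : A = {p}
    · subst hA1
      refine ⟨(Finset.univ.filter (fun d : Dir => p + vec d ∈ adom α)).image
        (fun d : Dir => (p, p + vec d)), ?_, ?_⟩
      · intro e he
        simp only [Finset.mem_image, Finset.mem_filter, Finset.mem_univ, true_and] at he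
        obtain ⟨d, hd, rfl⟩ := he
        exact ⟨rfl, by rw [hdom]; exact Or.inr hd, hvec d⟩
      · rw [Finset.sum_image (fun _ _ _ _ h => hinj h), hfil]
        exact h
    · refine key (A \ {p}) ?_ ?_ ?_ Set.sdiff_subset ?_
      · rintro q ⟨hq, hqp⟩
        have := hA hq
        rw [hdom] at this
        exact this.resolve_left hqp
      · by_contra hne
        rw [Set.not_nonempty_iff_eq_empty, Set.sdiff_eq_empty] at hne
        exact hA1 (hne.antisymm (by simpa using hpA))
      · obtain ⟨q, hq, hqA⟩ := hAc
        rw [hdom] at hq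
        refine ⟨q, hq.resolve_left fun h' => hqA (h' ▸ hpA), fun h' => hqA h'.1⟩
      · rintro q ⟨hq, hqA⟩
        refine ⟨by rw [hdom]; exact Or.inr hq, fun h' => hqA ⟨h', fun h'' => ?_⟩⟩
        exact hpα (by rw [← show q = p from h'']; exact hq)
  · have hAα : A ⊆ adom α := fun q hq => by
      have := hA hq
      rw [hdom] at this
      exact this.resolve_left fun h' => hpA (h' ▸ hq)
    by_cases hne : (adom α \ A).Nonempty
    · exact key A hAα hAne hne subset_rfl
        (Set.sdiff_subset_sdiff_left (by rw [hdom]; exact Set.subset_insert _ _))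
    · rw [Set.not_nonempty_iff_eq_empty, Set.sdiff_eq_empty] at hne
      refine ⟨(Finset.univ.filter (fun d : Dir => p + vec d ∈ adom α)).image
        (fun d : Dir => (p + vec d, p)), ?_, ?_⟩
      · intro e he
        simp only [Finset.mem_image, Finset.mem_filter, Finset.mem_univ, true_and] at he
        obtain ⟨d, hd, rfl⟩ := he
        exact ⟨hne hd, by rw [hdom]; exact Or.inl rfl, hpA⟩
      · rw [Finset.sum_image (fun _ _ _ _ h => hinj' h)]
        simp only [bondStrength_comm β _ p]
        rw [hfil]
        exact h

/-- A parity sign. -/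
def paritySign (z : ℤ) : ℤ := if Even z then 1 else -1

lemma paritySign_add_one (z : ℤ) : paritySign (z + 1) = -paritySign z := by
  unfold paritySign
  by_cases h : Even z
  · have : ¬ Even (z + 1) := by simpa [parity_simps] using h
    simp [h, this]
  · have : Even (z + 1) := by simpa [parity_simps] using h
    simp [h, this]

lemma paritySign_sub_one (z : ℤ) : paritySign (z - 1) = -paritySign z := by
  have := paritySign_add_one (z - 1)
  rw [sub_add_cancel] at this
  rw [this, _root_.neg_neg]

lemma paritySign_eq (z : ℤ) : paritySign z = 1 ∨ paritySign z = -1 := by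
  unfold paritySign; split_ifs <;> simp

/-- The label of weak glues, shared by a whole row or column up to sign. -/
def weakLabel (p : ℤ × ℤ) (v : Bool) : ℤ :=
  if v then paritySign p.2 * (Encodable.encode p.1 + 1)
  else paritySign p.1 * (Encodable.encode p.2 + 1)

/-- The label of strong glues, unique to each grid edge up to sign. -/
def strongLabel (p : ℤ × ℤ) (d : Dir) : ℤ :=
  if d.2 then (Encodable.encode (p, d.1) : ℤ) + 1
  else -((Encodable.encode (p + vec d, d.1) : ℤ) + 1)

lemma weakLabel_add_vec (p : ℤ × ℤ) (d : Dir) :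
    weakLabel (p + vec d) d.1 = -weakLabel p d.1 := by
  rcases d with ⟨_ | _, _ | _⟩ <;>
    simp [weakLabel, vec, paritySign_add_one, paritySign_sub_one, ← sub_eq_add_neg]

lemma strongLabel_add_vec (p : ℤ × ℤ) (d : Dir) :
    strongLabel (p + vec d) (neg d) = -strongLabel p d := by
  rcases d with ⟨v, _ | _⟩
  · simp [strongLabel, neg]
  · have := add_vec_neg p (v, true)
    simp [neg] at this
    simp [strongLabel, neg, this]

lemma weakLabel_inj {p q : ℤ × ℤ} {v : Bool} (h : weakLabel p v = weakLabel q v) :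
    if v then p.1 = q.1 else p.2 = q.2 := by
  have aux : ∀ a b : ℤ, ∀ x y : ℤ, paritySign x * ((Encodable.encode a : ℤ) + 1) =
      paritySign y * (Encodable.encode b + 1) → a = b := by
    intro a b x y h
    apply Encodable.encode_injective
    rcases paritySign_eq x with hx | hx <;> rcases paritySign_eq y with hy | hy <;>
      rw [hx, hy] at h <;> omega
  unfold weakLabel at h
  cases v
  · simpa using aux _ _ _ _ h
  · simpa using aux _ _ _ _ h

lemma strongLabel_inj {p q : ℤ × ℤ} {d e : Dir} (h : strongLabel p d = strongLabel q e) :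
    p = q ∧ d = e := by
  rcases d with ⟨v, _ | _⟩ <;> rcases e with ⟨w, _ | _⟩ <;> simp only [strongLabel] at h
  · have h1 : p + vec (v, false) = q + vec (w, false) ∧ v = w := by
      simp at h; exact_mod_cast h
    obtain ⟨h3, rfl⟩ := h1
    exact ⟨add_right_cancel h3, rfl⟩
  · simp at h; omega
  · simp at h; omega
  · have h1 : p = q ∧ v = w := by
      simp at h; exact_mod_cast h
    obtain ⟨rfl, rfl⟩ := h1
    exact ⟨rfl, rfl⟩

/-- The glue of strength `s` on side `d` of position `p`. -/
def glue (s : ℕ) (p : ℤ × ℤ) (d : Dir) : Glue :=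
  if s = 0 then none else some (if s = 1 then weakLabel p d.1 else strongLabel p d, s)

lemma glue_neg (s : ℕ) (p : ℤ × ℤ) (d : Dir) :
    (s = 0 ∧ glue s p d = none ∧ glue s (p + vec d) (neg d) = none) ∨
      ∃ l, glue s p d = some (l, s) ∧ glue s (p + vec d) (neg d) = some (-l, s) := by
  unfold glue
  by_cases h0 : s = 0
  · simp [h0]
  · right
    simp only [h0, if_false]
    refine ⟨_, rfl, ?_⟩
    by_cases h1 : s = 1
    · simp [h1, weakLabel_add_vec]
    · simp [h1, strongLabel_add_vec]

lemma glueMatch_glue (s : ℕ) (p : ℤ × ℤ) (d : Dir) :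
    GlueMatch (glue s p d) (glue s (p + vec d) (neg d)) := by
  rcases glue_neg s p d with h | ⟨l, h1, h2⟩
  · exact Or.inl h.2
  · exact Or.inr ⟨l, _, h1, h2⟩

lemma glueBind_glue (s : ℕ) (p : ℤ × ℤ) (d : Dir) :
    glueBind (glue s p d) (glue s (p + vec d) (neg d)) = s := by
  rcases glue_neg s p d with ⟨h0, h1, h2⟩ | ⟨l, h1, h2⟩
  · rw [h1, h2, h0]; rfl
  · simp [h1, h2, glueBind]

/-- If side `e` of the tile of `q`, placed at `p`, binds in direction `d`, then its glue is
the one planned at `p`. -/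
lemma of_glueBind {s t : ℕ} {p q : ℤ × ℤ} {d e : Dir} (he : e.1 = d.1)
    (hb : glueBind (glue t q e) (glue s (p + vec d) (neg d)) ≠ 0) :
    glueBind (glue t q e) (glue s (p + vec d) (neg d)) = s ∧ glue t q e = glue s p d ∧
      (if d.1 then p.1 = q.1 else p.2 = q.2) ∧ (s ≠ 1 → p = q ∧ d = e) := by
  rcases glue_neg s p d with ⟨-, -, h2⟩ | ⟨l, h1, h2⟩
  · rw [h2] at hb
    rcases h : glue t q e with _ | ⟨a, b⟩ <;> rw [h] at hb <;> exact absurd rfl hb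
  rcases hq : glue t q e with _ | ⟨m, t'⟩
  · rw [hq] at hb; exact absurd rfl hb
  rw [h2] at hb ⊢
  rw [hq] at hb
  simp only [glueBind] at hb ⊢
  have hms : -l = -m ∧ s = t' := by
    by_contra h'
    exact hb (if_neg h')
  obtain ⟨hm, rfl⟩ := hms
  have hm : l = m := by omega
  subst hm
  have hge : glue t q e = glue s p d := by rw [hq, h1]
  have h0 : s ≠ 0 := by
    rintro rfl
    simp [glue] at h1
  have hge' := hge
  unfold glue at hge'
  rw [if_neg h0] at hge'
  have hts : t = s := by
    split_ifs at hge' <;> simp only [Option.some.injEq, Prod.mk.injEq] at hge' <;> exact hge'.2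
  subst hts
  rw [if_neg h0] at hge'
  simp only [Option.some.injEq, Prod.mk.injEq, and_true, he] at hge'
  refine ⟨by simp, h1.symm, ?_, ?_⟩
  · by_cases h1 : t = 1
    · rw [if_pos h1, if_pos h1] at hge'
      exact weakLabel_inj hge'.symm
    · rw [if_neg h1, if_neg h1] at hge'
      obtain ⟨rfl, -⟩ := strongLabel_inj hge'
      split_ifs <;> rfl
  · intro h1
    rw [if_neg h1, if_neg h1] at hge'
    obtain ⟨rfl, h3⟩ := strongLabel_inj hge'
    exact ⟨rfl, h3.symm⟩

lemma glue_one_congr (p : ℤ × ℤ) {d e : Dir} (h : e.1 = d.1) : glue 1 p e = glue 1 p d := by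
  simp [glue, h]

/-- A plan for assembling `X` from a seed position: strengths of all glues, the input sides
of each tile, and a rank that decreases along inputs. -/
structure Blueprint (X : Set (ℤ × ℤ)) (W : Type) [LT W] where
  seed : ℤ × ℤ
  str : ℤ × ℤ → Dir → ℕ
  inp : ℤ × ℤ → Dir → Prop
  rank : ℤ × ℤ → W
  seed_mem : seed ∈ X
  str_symm : ∀ p d, p ∈ X → p + vec d ∈ X → str p d = str (p + vec d) (neg d)
  inp_mem : ∀ p d, p ∈ X → inp p d → p + vec d ∈ X
  inp_rank : ∀ p d, p ∈ X → inp p d → rank (p + vec d) < rank p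
  between : ∀ p d, p + vec d ∈ X → p + vec (neg d) ∈ X → p ∈ X
  attachable : ∀ p ∈ X, p ≠ seed → ∃ a b,
    (inp p a ∧ str p a = 2 ∧ (∀ d, inp p d → d = a) ∧ str p b ≤ 1 ∧
      (∀ d, p + vec d ∈ X → ¬ inp (p + vec d) (neg d) → d ≠ a → d ≠ b → str p d = 0) ∧
      (∀ d, d.1 ≠ a.1 → str p d = 1)) ∨
    (inp p a ∧ inp p b ∧ a.1 ≠ b.1 ∧ str p a = 1 ∧ str p b = 1 ∧
      (∀ d, inp p d → d = a ∨ d = b) ∧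
      (∀ d, p + vec d ∈ X → ¬ inp (p + vec d) (neg d) → d ≠ a → d ≠ b → str p d = 0))

namespace Blueprint

variable {X : Set (ℤ × ℤ)} {W : Type} [LT W] (P : Blueprint X W)

/-- The tile placed at `p` when the plan is followed. -/
def tile (p : ℤ × ℤ) : TileType := tileOf fun d => glue (P.str p d) p d

/-- The single-tile seed assembly. -/
def seedAssembly : Assembly :=
  Function.update (fun _ => none) P.seed (some (P.tile P.seed, (false, false)))

lemma adom_seedAssembly : adom P.seedAssembly = {P.seed} := by
  rw [seedAssembly, adom_update]
  ext q; simp [adom]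

lemma stable_seedAssembly (τ : ℕ) : Stable P.seedAssembly τ := by
  intro A hA hne hc
  rw [adom_seedAssembly] at hA hc
  obtain ⟨q, hq, hqA⟩ := hc
  obtain ⟨a, ha⟩ := hne
  have h1 : a = P.seed := hA ha
  have h2 : q = P.seed := hq
  exact absurd (by rw [h2, ← h1]; exact ha) hqA

/-- The tile system following the plan. -/
noncomputable def system (hX : X.Finite) : RTAS where
  tiles := by classical exact hX.toFinset.image P.tile
  seed := P.seedAssembly
  temp := 2
  seed_nonempty := by rw [adom_seedAssembly]; exact ⟨_, rfl⟩
  seed_finite := by rw [adom_seedAssembly]; exact Set.finite_singleton _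
  seed_tiles := by
    intro p pl h
    by_cases hp : p = P.seed
    · subst hp
      simp only [seedAssembly, Function.update_self, Option.some.injEq] at h
      subst h
      classical
      exact Finset.mem_image.2 ⟨_, hX.mem_toFinset.2 P.seed_mem, rfl⟩
    · simp [seedAssembly, hp] at h
  seed_stable := P.stable_seedAssembly 2

/-- An assembly which conforms to the plan. -/
structure Sound (α : Assembly) : Prop where
  stable : Stable α 2
  seed : P.seed ∈ adom α
  mem : ∀ p pl, α p = some pl → p ∈ X
  facing : ∀ p pl, α p = some pl → ∀ d, facingGlue pl p (p + vec d) = glue (P.str p d) p d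
  closed : ∀ p ∈ adom α, ∀ d, P.inp p d → p + vec d ∈ adom α

lemma facingGlue_tile (p : ℤ × ℤ) (r : Reflection) (q : ℤ × ℤ) (d : Dir) :
    facingGlue (P.tile q, r) p (p + vec d) = glue (P.str q (act r d)) q (act r d) :=
  facingGlue_tileOf _ _ _ _

lemma act_id (d : Dir) : act (false, false) d = d := by
  rcases d with ⟨_ | _, _ | _⟩ <;> rfl

variable {P}

lemma Sound.facing_back {α : Assembly} (h : P.Sound α) {p : ℤ × ℤ} {d : Dir} {pl : Placement}
    (hp : α (p + vec d) = some pl) :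
    facingGlue pl (p + vec d) p = glue (P.str (p + vec d) (neg d)) (p + vec d) (neg d) := by
  have := h.facing _ _ hp (neg d)
  rwa [add_vec_neg] at this

/-- The bond of a new tile with a neighbour already present. -/
lemma Sound.bond_update {α : Assembly} (h : P.Sound α) {p q : ℤ × ℤ} {r : Reflection} {d : Dir}
    (hd : p + vec d ∈ adom α) :
    bondStrength (Function.update α p (some (P.tile q, r))) p (p + vec d) =
      glueBind (glue (P.str q (act r d)) q (act r d)) (glue (P.str (p + vec d) (neg d)) (p + vec d) (neg d)) := by
  obtain ⟨pl, hpl⟩ := Option.ne_none_iff_exists'.1 hd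
  have hne : p + vec d ≠ p := by simpa using vec_ne_zero d
  unfold bondStrength
  rw [Function.update_self, Function.update_of_ne hne, hpl]
  simp only
  rw [P.facingGlue_tile, h.facing_back hpl]

lemma bond_update_eq_zero {α : Assembly} {p : ℤ × ℤ} {pl : Placement} {d : Dir}
    (hd : p + vec d ∉ adom α) :
    bondStrength (Function.update α p (some pl)) p (p + vec d) = 0 := by
  have hne : p + vec d ≠ p := by simpa using vec_ne_zero d
  apply bondStrength_of_right
  rw [Function.update_of_ne hne]
  by_contra h
  exact hd h

/-- A sum of at least two over directions has a large term or two positive ones. -/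
lemma exists_of_two_le_sum {f : Dir → ℕ} (h : 2 ≤ ∑ d, f d) :
    (∃ d, 2 ≤ f d) ∨ ∃ d e, d ≠ e ∧ f d = 1 ∧ f e = 1 := by
  by_contra hcon
  push Not at hcon
  obtain ⟨h1, h2⟩ := hcon
  have e1 := h2 (true, true) (true, false) (by simp)
  have e2 := h2 (true, true) (false, true) (by simp)
  have e3 := h2 (true, true) (false, false) (by simp)
  have e4 := h2 (true, false) (false, true) (by simp)
  have e5 := h2 (true, false) (false, false) (by simp)
  have e6 := h2 (false, true) (false, false) (by simp)
  have f1 := h1 (true, true)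
  have f2 := h1 (true, false)
  have f3 := h1 (false, true)
  have f4 := h1 (false, false)
  simp only [Fintype.sum_prod_type, Fintype.sum_bool] at h
  omega

/-- The only tile that can attach at an empty position is the planned one, and its glues
match the plan. -/
lemma Sound.attach_aux {α : Assembly} (h : P.Sound α) {p q : ℤ × ℤ} {r : Reflection}
    (hp : α p = none) (hq : q ∈ X)
    (hb : 2 ≤ totalBond (Function.update α p (some (P.tile q, r))) p) :
    p = q ∧ (∀ d, glue (P.str p (act r d)) p (act r d) = glue (P.str p d) p d) ∧
      ∀ d, P.inp p d → p + vec d ∈ adom α := by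
  have hps : p ≠ P.seed := fun hps => h.seed (hps ▸ hp)
  set b : Dir → ℕ := fun d =>
    bondStrength (Function.update α p (some (P.tile q, r))) p (p + vec d) with hbdef
  have hpos : ∀ d, b d ≠ 0 → p + vec d ∈ adom α := fun d hd => by
    by_contra h'
    exact hd (bond_update_eq_zero h')
  have hmemX : ∀ d, p + vec d ∈ adom α → p + vec d ∈ X := fun d hd => by
    obtain ⟨pl, hpl⟩ := Option.ne_none_iff_exists'.1 hd
    exact h.mem _ _ hpl
  have hopen : ∀ d, p + vec d ∈ adom α → ¬ P.inp (p + vec d) (neg d) := fun d hd hi => by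
    have := h.closed _ hd _ hi
    rw [add_vec_neg] at this
    exact this hp
  have hinfo : ∀ d, b d ≠ 0 → b d = P.str (p + vec d) (neg d) ∧
      glue (P.str q (act r d)) q (act r d) = glue (P.str (p + vec d) (neg d)) p d ∧
      (if d.1 then p.1 = q.1 else p.2 = q.2) ∧
      (P.str (p + vec d) (neg d) ≠ 1 → p = q ∧ d = act r d) := by
    intro d hd
    have hdd := hpos d hd
    have e : b d = _ := h.bond_update hdd
    rw [e] at hd ⊢
    exact of_glueBind (act_fst r d) hd
  have hpX : p ∈ X := by
    rcases exists_of_two_le_sum hb with ⟨d, hd⟩ | ⟨d, e, hde, hd, he⟩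
    · have hd : 2 ≤ b d := hd
      obtain ⟨h1, -, -, h4⟩ := hinfo d (by omega)
      rw [(h4 (by omega)).1]
      exact hq
    · have hd : b d = 1 := hd
      have he : b e = 1 := he
      obtain ⟨-, -, h3, -⟩ := hinfo d (by omega)
      obtain ⟨-, -, h3', -⟩ := hinfo e (by omega)
      by_cases hax : e.1 = d.1
      · rcases eq_or_neg_of_axis hax with rfl | rfl
        · exact absurd rfl hde
        · exact P.between p d (hmemX d (hpos d (by omega))) (hmemX _ (hpos _ (by omega)))
      · have : p = q := by
          rcases d with ⟨_ | _, _⟩ <;> rcases e with ⟨_ | _, _⟩ <;> simp at h3 h3' hax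
          · exact Prod.ext h3' h3
          · exact Prod.ext h3 h3'
        rw [this]; exact hq
  have hstr : ∀ d, b d ≠ 0 → b d = P.str p d := fun d hd => by
    rw [P.str_symm p d hpX (hmemX d (hpos d hd))]
    exact (hinfo d hd).1
  obtain ⟨a, c, ⟨ha, ha2, hin, hc, hz, hperp⟩ | ⟨ha, hc, hac, ha1, hc1, hin, hz⟩⟩ :=
    P.attachable p hpX hps
  · have hz' : ∀ d, b d ≠ 0 → d = a ∨ d = c := fun d hd => by
      by_contra hcon
      push Not at hcon
      have := hz d (hmemX d (hpos d hd)) (hopen d (hpos d hd)) hcon.1 hcon.2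
      rw [hstr d hd] at hd
      exact hd this
    have hba : b a ≠ 0 := by
      rcases exists_of_two_le_sum hb with ⟨d, hd⟩ | ⟨d, e, hde, hd, he⟩
      · have hd : 2 ≤ b d := hd
        rcases hz' d (by omega) with rfl | rfl
        · omega
        · rw [hstr d (by omega)] at hd
          omega
      · have hd : b d = 1 := hd
        have he : b e = 1 := he
        rcases hz' d (by omega) with rfl | rfl
        · omega
        · rcases hz' e (by omega) with rfl | rfl
          · omega
          · exact absurd rfl hde
    have hba2 := hstr a hba
    obtain ⟨h1, -, -, h4⟩ := hinfo a hba
    obtain ⟨rfl, hact⟩ := h4 (by omega)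
    refine ⟨rfl, fun d => ?_, fun d hd => by rw [hin d hd]; exact hpos a hba⟩
    by_cases hda : d.1 = a.1
    · rw [act_eq_of_axis hact.symm hda]
    · rw [hperp d hda, hperp (act r d) hda]
      exact glue_one_congr p (act_fst r d)
  · have hz' : ∀ d, b d ≠ 0 → d = a ∨ d = c := fun d hd => by
      by_contra hcon
      push Not at hcon
      have := hz d (hmemX d (hpos d hd)) (hopen d (hpos d hd)) hcon.1 hcon.2
      rw [hstr d hd] at hd
      exact hd this
    have hboth : b a ≠ 0 ∧ b c ≠ 0 := by
      rcases exists_of_two_le_sum hb with ⟨d, hd⟩ | ⟨d, e, hde, hd, he⟩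
      · have hd : 2 ≤ b d := hd
        have := hstr d (by omega)
        rcases hz' d (by omega) with rfl | rfl <;> omega
      · have hd : b d = 1 := hd
        have he : b e = 1 := he
        rcases hz' d (by omega) with rfl | rfl <;> rcases hz' e (by omega) with rfl | rfl
        · exact absurd rfl hde
        · omega
        · omega
        · exact absurd rfl hde
    obtain ⟨-, g1, x1, -⟩ := hinfo a hboth.1
    obtain ⟨-, g2, x2, -⟩ := hinfo c hboth.2
    have hpq : p = q := by
      rcases a with ⟨_ | _, _⟩ <;> rcases c with ⟨_ | _, _⟩ <;> simp at x1 x2 hac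
      · exact Prod.ext x2 x1
      · exact Prod.ext x1 x2
    subst hpq
    rw [← P.str_symm p a hpX (hmemX a (hpos a hboth.1))] at g1
    rw [← P.str_symm p c hpX (hmemX c (hpos c hboth.2))] at g2
    have hside : ∀ a d : Dir, d.1 = a.1 →
        glue (P.str p (act r a)) p (act r a) = glue (P.str p a) p a →
        glue (P.str p (act r d)) p (act r d) = glue (P.str p d) p d := by
      intro a d hda hg
      rcases act_eq_or_neg r a with hact | hact
      · rw [act_eq_of_axis hact hda]
      · rcases eq_or_neg_of_axis hda with rfl | rfl
        · exact hg
        · have : act r (neg a) = a := by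
            rcases act_eq_or_neg r (neg a) with h' | h'
            · exfalso
              have := act_eq_of_axis (e := a) h' rfl
              rw [hact] at this
              exact neg_ne a this
            · rw [h', neg_neg']
          rw [this, ← hg, hact]
    refine ⟨rfl, fun d => ?_, fun d hd => ?_⟩
    · by_cases hda : d.1 = a.1
      · exact hside a d hda g1
      · refine hside c d ?_ g2
        revert hda hac
        cases d.1 <;> cases a.1 <;> cases c.1 <;> simp
    · rcases hin d hd with rfl | rfl
      · exact hpos _ hboth.1
      · exact hpos _ hboth.2

lemma adjacent_of_sound {α : Assembly} (h : P.Sound α) {p : ℤ × ℤ} {d : Dir} {a b : Placement}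
    (ha : α p = some a) (hb : α (p + vec d) = some b) :
    facingGlue a p (p + vec d) = glue (P.str p d) p d ∧
      facingGlue b (p + vec d) p = glue (P.str p d) (p + vec d) (neg d) := by
  refine ⟨h.facing _ _ ha d, ?_⟩
  rw [h.facing_back hb, P.str_symm p d (h.mem _ _ ha) (h.mem _ _ hb)]

lemma sound_seedAssembly (hseed : ∀ d, ¬ P.inp P.seed d) : P.Sound P.seedAssembly where
  stable := P.stable_seedAssembly 2
  seed := by rw [adom_seedAssembly]; rfl
  mem := by
    intro p pl h
    have : p ∈ adom P.seedAssembly := by simp [adom, h]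
    rw [adom_seedAssembly] at this
    rw [show p = P.seed from this]
    exact P.seed_mem
  facing := by
    intro p pl h d
    have hp : p ∈ adom P.seedAssembly := by simp [adom, h]
    rw [adom_seedAssembly] at hp
    have hp : p = P.seed := hp
    subst hp
    simp only [seedAssembly, Function.update_self, Option.some.injEq] at h
    subst h
    rw [P.facingGlue_tile, act_id]
  closed := by
    intro p hp d hd
    rw [adom_seedAssembly] at hp
    rw [show p = P.seed from hp] at hd
    exact absurd hd (hseed d)

lemma Sound.attaches {hX : X.Finite} {α β : Assembly} (h : P.Sound α)
    (hβ : Attaches (P.system hX) α β) : P.Sound β := by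
  obtain ⟨p, t, r, hp, ht, rfl, hst⟩ := hβ
  have hst : Stable _ 2 := hst
  obtain ⟨q, hq, rfl⟩ : ∃ q ∈ X, P.tile q = t := by
    classical
    simpa [system] using ht
  have hdom := adom_update α p (P.tile q, r)
  have hps : P.seed ≠ p := fun hps => h.seed (hps ▸ hp)
  have hb := le_totalBond_of_stable hst (p := p) (q := P.seed) (by rw [hdom]; exact Or.inl rfl)
    (by rw [hdom]; exact Or.inr h.seed) hps
  obtain ⟨rfl, hg, hin⟩ := h.attach_aux hp hq hb
  refine ⟨hst, by rw [hdom]; exact Or.inr h.seed, ?_, ?_, ?_⟩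
  · intro q pl hqpl
    by_cases hqp : q = p
    · rwa [hqp]
    · rw [Function.update_of_ne hqp] at hqpl
      exact h.mem _ _ hqpl
  · intro q pl hqpl d
    by_cases hqp : q = p
    · subst hqp
      rw [Function.update_self, Option.some.injEq] at hqpl
      subst hqpl
      rw [P.facingGlue_tile, hg]
    · rw [Function.update_of_ne hqp] at hqpl
      exact h.facing _ _ hqpl d
  · intro q hq' d hd
    rw [hdom] at hq' ⊢
    rcases hq' with rfl | hq'
    · exact Or.inr (hin d hd)
    · exact Or.inr (h.closed q hq' d hd)

lemma eq_of_attaches {S : RTAS} {α β : Assembly} (h : β = α ∨ Attaches S α β) {p : ℤ × ℤ}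
    {pl : Placement} (hp : α p = some pl) : β p = some pl := by
  rcases h with rfl | ⟨q, t, r, hq, -, rfl, -⟩
  · exact hp
  · rw [Function.update_of_ne, hp]
    rintro rfl
    rw [hq] at hp
    cases hp

/-- All producible assemblies are finite stages, and conform to the plan. -/
lemma sound_of_producible {hX : X.Finite} (hseed : ∀ d, ¬ P.inp P.seed d) {α : Assembly}
    (h : Producible (P.system hX) α) : P.Sound α := by
  obtain ⟨f, h0, hstep, hlim⟩ := h
  have hs : ∀ n, P.Sound (f n) := by
    intro n
    induction n with
    | zero => rw [h0]; exact sound_seedAssembly hseed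
    | succ n ih =>
      rcases hstep n with h | h
      · rw [h]; exact ih
      · exact ih.attaches h
  have hmono : ∀ p pl n m, n ≤ m → f n p = some pl → f m p = some pl := by
    intro p pl n m hnm hn
    induction m, hnm using Nat.le_induction with
    | base => exact hn
    | succ m _ ih => exact eq_of_attaches (hstep m) ih
  have hsub : ∀ p pl, α p = some pl → p ∈ X := fun p pl hp => by
    obtain ⟨n, hn⟩ := (hlim p pl).1 hp
    exact (hs n).mem _ _ hn
  have hN : ∀ p, ∃ n, ∀ pl, α p = some pl → f n p = some pl := by
    intro p
    rcases hp : α p with _ | pl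
    · exact ⟨0, fun pl h => by cases h⟩
    · obtain ⟨n, hn⟩ := (hlim p pl).1 hp
      exact ⟨n, fun pl' h => by rw [hn]; exact h⟩
  choose N hN using hN
  obtain ⟨M, hM⟩ := (hX.image N).bddAbove
  have : α = f M := by
    funext p
    rcases hp : α p with _ | pl
    · rcases hf : f M p with _ | pl
      · rfl
      · rw [(hlim p pl).2 ⟨M, hf⟩] at hp
        cases hp
    · exact (hmono p pl _ M (hM ⟨p, hsub p pl hp, rfl⟩) (hN p pl hp)).symm
  rw [this]
  exact hs M

lemma Sound.two_le_totalBond {α : Assembly} (h : P.Sound α) {p : ℤ × ℤ} (hp : p ∈ X)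
    (hps : p ≠ P.seed) (hin : ∀ d, P.inp p d → p + vec d ∈ adom α) :
    2 ≤ totalBond (Function.update α p (some (P.tile p, (false, false)))) p := by
  have hbond : ∀ d, P.inp p d →
      bondStrength (Function.update α p (some (P.tile p, (false, false)))) p (p + vec d) =
        P.str p d := by
    intro d hd
    rw [h.bond_update (hin d hd), act_id, ← P.str_symm p d hp (P.inp_mem p d hp hd),
      glueBind_glue]
  obtain ⟨a, c, ⟨ha, ha2, -⟩ | ⟨ha, hc, hac, ha1, hc1, -⟩⟩ := P.attachable p hp hps
  · rw [← ha2, ← hbond a ha]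
    exact Finset.single_le_sum (f := fun d => bondStrength _ p (p + vec d))
      (fun _ _ => Nat.zero_le _) (Finset.mem_univ a)
  · have hne : a ≠ c := fun h => hac (by rw [h])
    have := Finset.sum_le_univ_sum_of_nonneg (s := {a, c}) (f := fun d => bondStrength
      (Function.update α p (some (P.tile p, (false, false)))) p (p + vec d))
      (fun _ => Nat.zero_le _)
    rw [Finset.sum_pair hne, hbond a ha, hbond c hc, ha1, hc1] at this
    exact this

/-- A blueprint whose seed needs no inputs yields a system assembling the planned set. -/
theorem assembles {X : Set (ℤ × ℤ)} (P : Blueprint X W)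
    (hX : X.Finite) (hwf : WellFounded fun a b : W => a < b) (hseed : ∀ d, ¬ P.inp P.seed d) :
    ∃ Sys : RTAS, Sys.temp = 2 ∧ SinglySeeded Sys ∧ MismatchFree Sys ∧
      StrictlySelfAssembles Sys X := by
  refine ⟨P.system hX, rfl, ⟨P.seed, P.adom_seedAssembly⟩, ?_, ?_⟩
  · intro α hα p q a b hpq ha hb
    have hs := sound_of_producible hseed hα
    obtain ⟨d, rfl⟩ := exists_vec_of_gridAdj hpq
    obtain ⟨h1, h2⟩ := adjacent_of_sound hs ha hb
    rw [h1, h2]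
    exact glueMatch_glue _ p d
  · rintro α ⟨hα, hterm⟩
    have hs := sound_of_producible hseed hα
    refine ⟨(false, false), 0, ?_⟩
    have htr : adom (transform α (false, false) 0) = adom α := by
      ext p
      simp [adom, transform, Reflection.onPoint]
    rw [htr]
    apply Set.Subset.antisymm
    · intro p hp
      obtain ⟨pl, hpl⟩ := Option.ne_none_iff_exists'.1 hp
      exact hs.mem _ _ hpl
    · by_contra hne
      obtain ⟨p, ⟨hpX, hp⟩, hmin⟩ := (InvImage.wf P.rank hwf).has_min (X \ adom α)
        (by
          obtain ⟨p, h1, h2⟩ := Set.not_subset.1 hne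
          exact ⟨p, h1, h2⟩)
      have hpn : α p = none := by
        by_contra h
        exact hp h
      refine hterm _ ⟨p, P.tile p, (false, false), hpn, ?_, rfl,
        stable_update hs.stable hpn (hs.two_le_totalBond hpX ?_ ?_)⟩
      · classical
        exact Finset.mem_image.2 ⟨p, hX.mem_toFinset.2 hpX, rfl⟩
      · rintro rfl
        exact hp hs.seed
      · intro d hd
        by_contra h
        exact hmin _ ⟨P.inp_mem p d hpX hd, h⟩ (P.inp_rank p d hpX hd)

end Blueprint

/-- Cells of `S` reachable from `r` by a walk with `n` turns whose current straight run, which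
is vertical exactly when `n` is even, has length `m`. -/
inductive Reach (S : Set (ℤ × ℤ)) (r : ℤ × ℤ) : ℕ → ℕ → ℤ × ℤ → Prop
  | base : Reach S r 0 0 r
  | step {n m : ℕ} {p : ℤ × ℤ} {d : Dir} : Reach S r n m p → d.1 = !n.bodd → p + vec d ∈ S →
      Reach S r n (m + 1) (p + vec d)
  | turn {n m : ℕ} {p : ℤ × ℤ} : Reach S r n m p → Reach S r (n + 1) 0 p

/-- A rooted growth order on `S`: every cell other than the root is grown from its predecessor
in direction `dir`, and a cell straight ahead which is grown along the other axis comes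
earlier. -/
structure Growth (S : Set (ℤ × ℤ)) where
  root : ℤ × ℤ
  dir : ℤ × ℤ → Dir
  time : ℤ × ℤ → ℕ ×ₗ ℕ
  root_mem : root ∈ S
  below_root : root + vec (true, false) ∉ S
  dir_root : dir root = (true, true)
  pred_mem : ∀ b ∈ S, b ≠ root → b + vec (neg (dir b)) ∈ S
  time_pred : ∀ b ∈ S, b ≠ root → time (b + vec (neg (dir b))) < time b
  time_ahead : ∀ b ∈ S, b + vec (dir b) ∈ S → (dir (b + vec (dir b))).1 ≠ (dir b).1 →
    time (b + vec (dir b)) < time b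
  ahead_root : root + vec (dir root) ∈ S → (dir (root + vec (dir root))).1 = (dir root).1

lemma Reach.mem {S : Set (ℤ × ℤ)} {r : ℤ × ℤ} (hr : r ∈ S) {n m : ℕ} {p : ℤ × ℤ}
    (h : Reach S r n m p) : p ∈ S := by
  induction h with
  | base => exact hr
  | step _ _ h _ => exact h
  | turn _ ih => exact ih

lemma exists_reach {S : Set (ℤ × ℤ)} (hS : GridConnectedOn S) {r p : ℤ × ℤ} (hr : r ∈ S)
    (hp : p ∈ S) : ∃ n m, Reach S r n m p := by
  have := hS r hr p hp
  clear hp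
  induction this with
  | refl => exact ⟨0, 0, .base⟩
  | tail _ hbc ih =>
    obtain ⟨n, m, h⟩ := ih
    obtain ⟨hadj, -, hc⟩ := hbc
    obtain ⟨d, rfl⟩ := exists_vec_of_gridAdj hadj
    by_cases hd : d.1 = !n.bodd
    · exact ⟨_, _, h.step hd hc⟩
    · refine ⟨n + 1, 1, h.turn.step ?_ hc⟩
      revert hd
      rw [Nat.bodd_succ]
      cases d.1 <;> cases n.bodd <;> simp

theorem nonempty_growth {S : Set (ℤ × ℤ)} (hS : IsShape S) : Nonempty (Growth S) := by
  obtain ⟨hfin, hne, hcon⟩ := hS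
  obtain ⟨r, hr, hmin⟩ := hfin.exists_minimalFor Prod.snd S hne
  have hbelow : r + vec (true, false) ∉ S := by
    intro h
    have := hmin h
    simp [vec] at this
  have hk : ∀ b ∈ S, ∃ x : ℕ ×ₗ ℕ, Reach S r (ofLex x).1 (ofLex x).2 b ∧
      ∀ y : ℕ ×ₗ ℕ, Reach S r (ofLex y).1 (ofLex y).2 b → x ≤ y := by
    intro b hb
    obtain ⟨n, m, h⟩ := exists_reach hcon hr hb
    obtain ⟨x, hx, hxm⟩ := (wellFounded_lt (α := ℕ ×ₗ ℕ)).has_min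
      {x | Reach S r (ofLex x).1 (ofLex x).2 b} ⟨toLex (n, m), h⟩
    exact ⟨x, hx, fun y hy => not_lt.1 (hxm y hy)⟩
  choose! k hkr hkm using hk
  have hk0 : k r = toLex (0, 0) := by
    refine le_antisymm (hkm r hr _ .base) ?_
    rw [Prod.Lex.le_iff]
    simp
    omega
  have hd : ∀ b ∈ S, ∃ d : Dir, d.1 = (!(ofLex (k b)).1.bodd) ∧ (b = r → d = (true, true)) ∧
      (b ≠ r → b + vec (neg d) ∈ S ∧ k (b + vec (neg d)) < k b) := by
    intro b hb
    by_cases hbr : b = r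
    · subst hbr
      exact ⟨(true, true), by simp [hk0], fun _ => rfl, fun h => absurd rfl h⟩
    have hreach := hkr b hb
    have hmin' := hkm b hb
    generalize hx : k b = x at hreach hmin'
    obtain ⟨⟨n, m⟩, rfl⟩ := toLex.surjective x
    change Reach S r n m b at hreach
    cases hreach with
    | base => exact absurd rfl hbr
    | @step _ m p d h hdn hpS =>
      refine ⟨d, hdn, fun h' => absurd h' hbr, fun _ => ?_⟩
      rw [add_vec_neg]
      refine ⟨h.mem hr, lt_of_le_of_lt (hkm p (h.mem hr) (toLex (n, m)) h) ?_⟩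
      rw [Prod.Lex.lt_iff]
      exact Or.inr ⟨rfl, Nat.lt_succ_self m⟩
    | @turn n m _ h =>
      exfalso
      have := hmin' (toLex (n, m)) h
      rw [Prod.Lex.le_iff] at this
      rcases this with h' | h'
      · exact absurd h' (by change ¬ (n + 1 < n); omega)
      · exact absurd h'.1 (by change ¬ (n + 1 = n); omega)
  choose! u hu hur hup using hd
  have hahead : ∀ b ∈ S, b + vec (u b) ∈ S → (u (b + vec (u b))).1 ≠ (u b).1 →
      k (b + vec (u b)) < k b := by
    intro b hb hf hax
    have h1 := hkm _ hf (toLex ((ofLex (k b)).1, (ofLex (k b)).2 + 1)) ((hkr b hb).step (hu b hb) hf)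
    rw [hu b hb, hu _ hf] at hax
    rw [Prod.Lex.le_iff] at h1
    rw [Prod.Lex.lt_iff]
    rcases h1 with h1 | h1
    · exact Or.inl h1
    · exact absurd (by rw [h1.1]; rfl) hax
  refine ⟨⟨r, u, k, hr, hbelow, hur r hr rfl, fun b hb hbr => (hup b hb hbr).1,
    fun b hb hbr => (hup b hb hbr).2, hahead, fun hf => ?_⟩⟩
  by_contra hax
  have := hahead r hr hf hax
  rw [hk0, Prod.Lex.lt_iff] at this
  rcases this with h | h
  · exact absurd h (Nat.not_lt_zero _)
  · exact absurd h.2 (Nat.not_lt_zero _)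

/-- The block of the 2-scaling containing a position. -/
def blk (p : ℤ × ℤ) : ℤ × ℤ := (p.1 / 2, p.2 / 2)

/-- Whether the neighbour of `p` in direction `d` lies in the same block. -/
def inside (p : ℤ × ℤ) (d : Dir) : Bool :=
  xor (decide ((if d.1 then p.2 else p.1) % 2 = 1)) d.2

/-- A colouring of positions by axes, alternating inside blocks and constant across block
boundaries. -/
def colour (p : ℤ × ℤ) : Bool := decide ((p.1 + p.2 + p.1 / 2 + p.2 / 2) % 2 = 1)

lemma mem_scaleShape_two {S : Set (ℤ × ℤ)} {p : ℤ × ℤ} : p ∈ scaleShape S 2 ↔ blk p ∈ S := by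
  simp [scaleShape, blk, Int.fdiv_eq_ediv_of_nonneg]

lemma inside_neg (p : ℤ × ℤ) (d : Dir) : inside p (neg d) = !inside p d := by
  rcases d with ⟨v, _ | _⟩ <;> simp [inside, neg]

lemma blk_add_of_inside {p : ℤ × ℤ} {d : Dir} (h : inside p d = true) :
    blk (p + vec d) = blk p := by
  obtain ⟨x, y⟩ := p
  rcases d with ⟨_ | _, _ | _⟩ <;> simp [inside, blk, vec] at h ⊢ <;> omega

lemma blk_add_of_not_inside {p : ℤ × ℤ} {d : Dir} (h : inside p d = false) :
    blk (p + vec d) = blk p + vec d := by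
  obtain ⟨x, y⟩ := p
  rcases d with ⟨_ | _, _ | _⟩ <;> simp [inside, blk, vec] at h ⊢ <;> omega

lemma inside_add_of_axis {p : ℤ × ℤ} {d e : Dir} (h : e.1 = d.1) :
    inside (p + vec d) e = !inside p e := by
  obtain ⟨x, y⟩ := p
  rcases d with ⟨_ | _, _ | _⟩ <;> rcases e with ⟨_ | _, _ | _⟩ <;> simp at h <;>
    rw [Bool.eq_iff_iff] <;> simp [inside, vec] <;> omega

lemma inside_add_of_ne {p : ℤ × ℤ} {d e : Dir} (h : e.1 ≠ d.1) :
    inside (p + vec d) e = inside p e := by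
  obtain ⟨x, y⟩ := p
  rcases d with ⟨_ | _, _ | _⟩ <;> rcases e with ⟨_ | _, _ | _⟩ <;> simp at h <;>
    simp [inside, vec]

lemma colour_add_of_inside {p : ℤ × ℤ} {d : Dir} (h : inside p d = true) :
    colour (p + vec d) = !colour p := by
  obtain ⟨x, y⟩ := p
  rcases d with ⟨_ | _, _ | _⟩ <;> rw [Bool.eq_iff_iff] <;>
    simp [inside, colour, vec] at h ⊢ <;> omega

lemma colour_add_of_not_inside {p : ℤ × ℤ} {d : Dir} (h : inside p d = false) :
    colour (p + vec d) = colour p := by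
  obtain ⟨x, y⟩ := p
  rcases d with ⟨_ | _, _ | _⟩ <;> rw [Bool.eq_iff_iff] <;>
    simp [inside, colour, vec] at h ⊢ <;> omega

lemma between_blk {S : Set (ℤ × ℤ)} {p : ℤ × ℤ} {d : Dir} (h : blk (p + vec d) ∈ S)
    (h' : blk (p + vec (neg d)) ∈ S) : blk p ∈ S := by
  rcases hi : inside p d with _ | _
  · rwa [blk_add_of_inside (by rw [inside_neg, hi]; rfl)] at h'
  · rwa [blk_add_of_inside hi] at h

namespace Growth

variable {S : Set (ℤ × ℤ)} (G : Growth S)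

/-- Whether one of the blocks `b` and `b + vec d` is grown from the other. -/
def Tree (b : ℤ × ℤ) (d : Dir) : Prop :=
  b + vec d ∈ S ∧ ((b + vec d ≠ G.root ∧ G.dir (b + vec d) = d) ∨
    (b ≠ G.root ∧ G.dir b = neg d))

/-- Whether the block next to `b` in direction `d` is grown along the other axis. -/
def Cross (b : ℤ × ℤ) (d : Dir) : Prop := b + vec d ∈ S ∧ (G.dir (b + vec d)).1 ≠ d.1

/-- The growth direction of the block containing `p`. -/
def heading (p : ℤ × ℤ) : Dir := G.dir (blk p)

/-- Whether `p` has the colour of the growth axis of its block. -/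
def own (p : ℤ × ℤ) : Bool := colour p == (G.heading p).1

/-- Whether `p` lies in the rear half of its block, as seen along the growth direction. -/
def rear (p : ℤ × ℤ) : Bool := inside p (G.heading p)

/-- The direction across the growth axis leading from `p` to a position of its block. -/
def across (p : ℤ × ℤ) : Dir :=
  (!(G.heading p).1, inside p (!(G.heading p).1, true))

/-- Whether the block containing `p` has a block grown along the other axis straight ahead. -/
def Blocked (p : ℤ × ℤ) : Prop := G.Cross (blk p) (G.heading p)

open Classical in
/-- The strength of a glue, depending on whether its side is parallel to the growth axis and
leads into the same block, on the role of the tile in its block, and on the adjacent blocks. -/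
noncomputable def strength (parallel ins own rear : Bool) (blocked tree cross root bottom : Prop) :
    ℕ :=
  if parallel then
    if ins then (if own = rear then (if blocked then 0 else 1) else 2)
    else if own then (if tree then 2 else if bottom then 1 else 0)
    else (if tree ∨ cross then 1 else 0)
  else if ins then (if root ∧ rear then 2 else 1)
  else if own then 1
  else (if tree then 2 else 0)

/-- The strength of the glue on side `d` of the tile of `p`. -/
noncomputable def str (p : ℤ × ℤ) (d : Dir) : ℕ :=
  strength (d.1 == (G.heading p).1) (inside p d) (G.own p) (G.rear p) (G.Blocked p)
    (G.Tree (blk p) d) (G.Cross (blk p) d) (blk p = G.root)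
    (blk p = G.root ∧ d = neg (G.heading p))

/-- The input sides of the tile of `p`. -/
def inp (p : ℤ × ℤ) (d : Dir) : Prop :=
  match G.own p, G.rear p with
  | true, true => (blk p = G.root ∧ d = G.across p) ∨ (blk p ≠ G.root ∧ d = neg (G.heading p))
  | true, false => d = neg (G.heading p)
  | false, true => blk p ≠ G.root ∧ (d = neg (G.heading p) ∨ d = G.across p)
  | false, false => d = G.across p ∨ (G.Blocked p ∧ d = G.heading p) ∨
      (¬ G.Blocked p ∧ d = neg (G.heading p))

open Classical in
/-- The position of `p` in the order in which the tiles of its block attach. -/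
noncomputable def stage (p : ℤ × ℤ) : ℕ :=
  match G.own p, G.rear p with
  | true, true => 1
  | true, false => 3
  | false, true => if blk p = G.root then 0 else 2
  | false, false => 4

variable {G}

lemma tree_neg {b : ℤ × ℤ} {d : Dir} (hb : b ∈ S) (hd : b + vec d ∈ S) :
    G.Tree (b + vec d) (neg d) ↔ G.Tree b d := by
  simp only [Tree, add_vec_neg, neg_neg', hb, hd, true_and]
  tauto

lemma ne_root_of_pred_mem {b : ℤ × ℤ} (hb : b ∈ S) :
    b + vec (neg (G.dir b)) ∈ S → b ≠ G.root := by
  rintro h rfl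
  rw [G.dir_root] at h
  exact G.below_root h

lemma heading_add_of_inside {p : ℤ × ℤ} {d : Dir} (h : inside p d = true) :
    G.heading (p + vec d) = G.heading p := by
  rw [heading, blk_add_of_inside h, heading]

lemma own_add_of_inside {p : ℤ × ℤ} {d : Dir} (h : inside p d = true) :
    G.own (p + vec d) = !G.own p := by
  rw [own, heading_add_of_inside h, colour_add_of_inside h, own]
  cases colour p <;> cases (G.heading p).1 <;> rfl

lemma rear_add_of_inside_axis {p : ℤ × ℤ} {d : Dir} (h : inside p d = true)
    (hd : d.1 = (G.heading p).1) : G.rear (p + vec d) = !G.rear p := by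
  rw [rear, heading_add_of_inside h, inside_add_of_axis hd.symm, rear]

lemma rear_add_of_inside_ne {p : ℤ × ℤ} {d : Dir} (h : inside p d = true)
    (hd : d.1 ≠ (G.heading p).1) : G.rear (p + vec d) = G.rear p := by
  rw [rear, heading_add_of_inside h, inside_add_of_ne hd.symm, rear]

lemma across_fst (p : ℤ × ℤ) : (G.across p).1 = !(G.heading p).1 := rfl

lemma across_fst_ne (p : ℤ × ℤ) : (G.across p).1 ≠ (G.heading p).1 := by
  rw [across_fst]; cases (G.heading p).1 <;> simp

lemma inside_across (p : ℤ × ℤ) : inside p (G.across p) = true := by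
  simp [across, inside]

lemma inside_neg_across (p : ℤ × ℤ) : inside p (neg (G.across p)) = false := by
  rw [inside_neg, inside_across]; rfl

lemma eq_across {p : ℤ × ℤ} {d : Dir} (h : inside p d = true) (hd : d.1 ≠ (G.heading p).1) :
    d = G.across p := by
  have hax : d.1 = (G.across p).1 := by
    rw [across_fst]
    revert hd
    cases d.1 <;> cases (G.heading p).1 <;> simp
  rcases eq_or_neg_of_axis hax with h' | h'
  · exact h'
  · rw [h', inside_neg_across] at h
    cases h

lemma dir_cases (p : ℤ × ℤ) (d : Dir) : d = G.heading p ∨ d = neg (G.heading p) ∨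
    d = G.across p ∨ d = neg (G.across p) := by
  by_cases h : d.1 = (G.heading p).1
  · rcases eq_or_neg_of_axis h with h | h <;> simp [h]
  · have hax : d.1 = (G.across p).1 := by
      rw [across_fst]
      revert h
      cases d.1 <;> cases (G.heading p).1 <;> simp
    rcases eq_or_neg_of_axis hax with h | h <;> simp [h]

lemma across_add_of_ne {p : ℤ × ℤ} {d : Dir} (h : inside p d = true)
    (hd : d.1 ≠ (G.heading p).1) : G.across (p + vec d) = neg (G.across p) := by
  symm
  apply eq_across
  · rw [eq_across h hd, inside_add_of_axis (neg_fst _), inside_neg_across]; rfl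
  · rw [heading_add_of_inside h, neg_fst]; exact across_fst_ne p

lemma own_add_of_not_inside {p : ℤ × ℤ} {d : Dir} (h : inside p d = false) :
    G.own (p + vec d) = (colour p == (G.dir (blk p + vec d)).1) := by
  rw [own, heading, blk_add_of_not_inside h, colour_add_of_not_inside h]

lemma str_symm {p : ℤ × ℤ} {d : Dir} (hp : blk p ∈ S) (hq : blk (p + vec d) ∈ S) :
    G.str p d = G.str (p + vec d) (neg d) := by
  have hin : inside (p + vec d) (neg d) = inside p d := by
    rw [inside_add_of_axis (neg_fst d), inside_neg, Bool.not_not]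
  rcases hi : inside p d with _ | _
  · have hb := blk_add_of_not_inside hi
    rw [hb] at hq
    have ht := tree_neg (G := G) hp hq
    have hr1 : ¬ (blk p = G.root ∧ d = neg (G.heading p)) := by
      rintro ⟨h1, rfl⟩
      exact ne_root_of_pred_mem hp hq h1
    have hr2 : ¬ (blk p + vec d = G.root ∧ neg d = neg (G.dir (blk p + vec d))) := by
      rintro ⟨h1, h2⟩
      refine ne_root_of_pred_mem (b := blk p + vec d) hq ?_ h1
      rw [← h2, add_vec_neg]
      exact hp
    have hc1 : G.Cross (blk p) d ↔ (G.dir (blk p + vec d)).1 ≠ d.1 := by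
      simp [Cross, hq]
    have hc2 : G.Cross (blk p + vec d) (neg d) ↔ (G.dir (blk p)).1 ≠ d.1 := by
      simp [Cross, hp]
    have ho1 : G.own p = (colour p == (G.dir (blk p)).1) := rfl
    have hh : G.heading (p + vec d) = G.dir (blk p + vec d) := by rw [heading, hb]
    unfold str
    rw [own_add_of_not_inside hi, hin, hi, eq_false hr1, hh, hb, eq_false hr2, ht, hc1, hc2,
      ho1, heading, neg_fst]
    cases d.1 <;> cases (G.dir (blk p)).1 <;> cases (G.dir (blk p + vec d)).1 <;>
      cases colour p <;> simp [strength]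
  · unfold str
    rw [hin, hi, Blocked, Blocked, heading_add_of_inside hi, own_add_of_inside hi,
      blk_add_of_inside hi, neg_fst]
    by_cases hd : d.1 = (G.heading p).1
    · rw [rear_add_of_inside_axis hi hd, hd]
      cases G.own p <;> cases G.rear p <;> simp [strength]
    · rw [rear_add_of_inside_ne hi hd, beq_false_of_ne hd]
      simp [strength]

/-- A tree edge out of `p` to a new block leads to the rear of that block. -/
lemma of_tree {p : ℤ × ℤ} {d : Dir} (hi : inside p d = false) (hd : d ≠ neg (G.heading p))
    (ht : G.Tree (blk p) d) :
    blk (p + vec d) ≠ G.root ∧ G.heading (p + vec d) = d ∧ G.rear (p + vec d) = true ∧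
      G.own (p + vec d) = (colour p == d.1) := by
  obtain ⟨hS, ⟨h1, h2⟩ | ⟨h1, h2⟩⟩ := ht
  · have hb := blk_add_of_not_inside hi
    have hh : G.heading (p + vec d) = d := by rw [heading, hb, h2]
    refine ⟨by rwa [hb], hh, ?_, ?_⟩
    · rw [rear, hh, inside_add_of_axis rfl, hi]; rfl
    · rw [own_add_of_not_inside hi, h2]
  · exact absurd (by rw [heading, h2, neg_neg']) hd

/-- The side of a new block facing a tree edge is an input. -/
lemma inp_of_tree {p : ℤ × ℤ} {d : Dir} (hi : inside p d = false)
    (hd : d ≠ neg (G.heading p)) (ht : G.Tree (blk p) d) :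
    G.inp (p + vec d) (neg d) := by
  obtain ⟨h1, h2, h3, -⟩ := of_tree hi hd ht
  unfold inp
  rw [h2, h3]
  cases G.own (p + vec d) <;> simp [h1]

lemma tree_pred {p : ℤ × ℤ} (hp : blk p ∈ S) (hr : blk p ≠ G.root) :
    G.Tree (blk p) (neg (G.heading p)) :=
  ⟨G.pred_mem _ hp hr, Or.inr ⟨hr, by rw [neg_neg']; rfl⟩⟩

lemma str_heading {p : ℤ × ℤ} {o r : Bool} (ho : G.own p = o) (hr : G.rear p = r) :
    G.str p (G.heading p) = strength true r o r (G.Blocked p) (G.Tree (blk p) (G.heading p))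
      (G.Blocked p) (blk p = G.root) False := by
  have : (blk p = G.root ∧ G.heading p = neg (G.heading p)) = False :=
    eq_false fun h => neg_ne _ h.2.symm
  rw [str, this, ho, hr, ← hr, beq_self_eq_true]
  rfl

lemma str_neg_heading {p : ℤ × ℤ} {o r : Bool} (ho : G.own p = o) (hr : G.rear p = r) :
    G.str p (neg (G.heading p)) = strength true (!r) o r (G.Blocked p)
      (G.Tree (blk p) (neg (G.heading p))) (G.Cross (blk p) (neg (G.heading p)))
      (blk p = G.root) (blk p = G.root) := by
  have : (blk p = G.root ∧ neg (G.heading p) = neg (G.heading p)) = (blk p = G.root) := by simp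
  rw [str, this, ho, hr, ← hr, neg_fst, beq_self_eq_true, inside_neg]
  rfl

lemma str_across {p : ℤ × ℤ} {o r : Bool} (ho : G.own p = o) (hr : G.rear p = r) :
    G.str p (G.across p) = if blk p = G.root ∧ r = true then 2 else 1 := by
  rw [str, ho, hr, beq_false_of_ne (across_fst_ne p), inside_across]
  simp [strength]

lemma str_neg_across {p : ℤ × ℤ} {o r : Bool} (ho : G.own p = o) (hr : G.rear p = r) :
    G.str p (neg (G.across p)) = strength false false o r False
      (G.Tree (blk p) (neg (G.across p))) False False False := by
  rw [str, ho, hr, neg_fst, beq_false_of_ne (across_fst_ne p), inside_neg_across]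
  simp [strength]

lemma seed_unique {p q : ℤ × ℤ} (h : blk p = blk q) (ho : G.own p = G.own q)
    (hr : G.rear p = G.rear q) : p = q := by
  have hh : G.heading p = G.heading q := by rw [heading, heading, h]
  rw [rear, rear, hh] at hr
  rw [own, own, hh] at ho
  have hc : colour p = colour q := by
    revert ho
    cases colour p <;> cases colour q <;> cases (G.heading q).1 <;> simp
  obtain ⟨x, y⟩ := p
  obtain ⟨x', y'⟩ := q
  generalize G.heading (x', y') = d at hr
  simp only [blk, Prod.mk.injEq] at h
  simp only [colour, decide_eq_decide] at hc
  rcases d with ⟨_ | _, _ | _⟩ <;> simp [inside] at hr <;> ext <;> simp <;> omega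


lemma exists_seed (b : ℤ × ℤ) (d : Dir) : ∃ p : ℤ × ℤ, blk p = b ∧ inside p d = true ∧
    (colour p == d.1) = false := by
  obtain ⟨x, y⟩ := b
  have h := Int.emod_two_eq_zero_or_one (x + y)
  rcases d with ⟨_ | _, _ | _⟩
  · exact ⟨(2 * x + 1, 2 * y + (x + y) % 2), by simp [blk]; omega, by simp [inside],
      by simp [colour]; omega⟩
  · exact ⟨(2 * x, 2 * y + (1 - (x + y) % 2)), by simp [blk]; omega, by simp [inside],
      by simp [colour]; omega⟩
  · exact ⟨(2 * x + (1 - (x + y) % 2), 2 * y + 1), by simp [blk]; omega, by simp [inside],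
      by simp [colour]; omega⟩
  · exact ⟨(2 * x + (x + y) % 2, 2 * y), by simp [blk]; omega, by simp [inside],
      by simp [colour]; omega⟩

lemma Blocked.ne_root {p : ℤ × ℤ} (h : G.Blocked p) : blk p ≠ G.root := by
  intro hr
  rw [Blocked, heading, hr] at h
  exact h.2 (G.ahead_root h.1)

lemma not_inside_neg_heading {p : ℤ × ℤ} (hr : G.rear p = true) :
    inside p (neg (G.heading p)) = false := by
  rw [inside_neg]
  rw [rear] at hr
  rw [hr]; rfl

lemma inside_neg_heading {p : ℤ × ℤ} (hr : G.rear p = false) :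
    inside p (neg (G.heading p)) = true := by
  rw [inside_neg]
  rw [rear] at hr
  rw [hr]; rfl

lemma stage_lt {p : ℤ × ℤ} {d : Dir} (h : inside p d = true) (hd : G.inp p d) :
    G.stage (p + vec d) < G.stage p := by
  have hax := across_fst_ne (G := G) p
  have h1 := rear_add_of_inside_ne (G := G) (inside_across (G := G) p) hax
  rw [inp] at hd
  rw [stage, stage, own_add_of_inside h, blk_add_of_inside h]
  rcases ho : G.own p with _ | _ <;> rcases hr : G.rear p with _ | _ <;> simp only [ho, hr] at hd
  · rcases hd with rfl | ⟨-, rfl⟩ | ⟨-, rfl⟩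
    · rw [h1, hr]; simp
    · rw [rear] at hr; rw [hr] at h; cases h
    · rw [rear_add_of_inside_axis h (neg_fst _), hr]; simp
  · obtain ⟨h2, rfl | rfl⟩ := hd
    · rw [not_inside_neg_heading hr] at h; cases h
    · rw [h1, hr]; simp [h2]
  · subst hd
    rw [rear_add_of_inside_axis h (neg_fst _), hr]
    by_cases h0 : blk p = G.root <;> simp [h0]
  · rcases hd with ⟨h2, rfl⟩ | ⟨-, rfl⟩
    · rw [h1, hr]; simp [h2]
    · rw [not_inside_neg_heading hr] at h; cases h

lemma inp_boundary {p : ℤ × ℤ} {d : Dir} (h : inside p d = false) (hd : G.inp p d) :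
    (blk p ≠ G.root ∧ d = neg (G.heading p)) ∨ (G.Blocked p ∧ d = G.heading p) := by
  have h1 := inside_across (G := G) p
  rw [inp] at hd
  rcases ho : G.own p with _ | _ <;> rcases hr : G.rear p with _ | _ <;> simp only [ho, hr] at hd
  · rcases hd with rfl | ⟨h2, rfl⟩ | ⟨-, rfl⟩
    · rw [h1] at h; cases h
    · exact Or.inr ⟨h2, rfl⟩
    · rw [inside_neg_heading hr] at h; cases h
  · obtain ⟨h2, rfl | rfl⟩ := hd
    · exact Or.inl ⟨h2, rfl⟩
    · rw [h1] at h; cases h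
  · rw [hd, inside_neg_heading hr] at h; cases h
  · rcases hd with ⟨-, rfl⟩ | ⟨h2, rfl⟩
    · rw [h1] at h; cases h
    · exact Or.inl ⟨h2, rfl⟩

lemma inp_spec {p : ℤ × ℤ} {d : Dir} (hp : blk p ∈ S) (hd : G.inp p d) :
    blk (p + vec d) ∈ S ∧ (G.time (blk (p + vec d)) < G.time (blk p) ∨
      (G.time (blk (p + vec d)) = G.time (blk p) ∧ G.stage (p + vec d) < G.stage p)) := by
  rcases hi : inside p d with _ | _
  · rw [blk_add_of_not_inside hi]
    rcases inp_boundary hi hd with ⟨h, rfl⟩ | ⟨h, rfl⟩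
    · exact ⟨G.pred_mem _ hp h, Or.inl (G.time_pred _ hp h)⟩
    · exact ⟨h.1, Or.inl (G.time_ahead _ hp h.1 h.2)⟩
  · rw [blk_add_of_inside hi]
    exact ⟨hp, Or.inr ⟨rfl, stage_lt hi hd⟩⟩

/-- A side carrying a glue is either an input or an output, with at most one exception. -/
lemma attachable {p : ℤ × ℤ} (hp : blk p ∈ S)
    (hseed : blk p = G.root → G.rear p = true → G.own p = true) : ∃ a b,
    (G.inp p a ∧ G.str p a = 2 ∧ (∀ d, G.inp p d → d = a) ∧ G.str p b ≤ 1 ∧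
      (∀ d, blk (p + vec d) ∈ S → ¬ G.inp (p + vec d) (neg d) → d ≠ a → d ≠ b →
        G.str p d = 0) ∧
      (∀ d, d.1 ≠ a.1 → G.str p d = 1)) ∨
    (G.inp p a ∧ G.inp p b ∧ a.1 ≠ b.1 ∧ G.str p a = 1 ∧ G.str p b = 1 ∧
      (∀ d, G.inp p d → d = a ∨ d = b) ∧
      (∀ d, blk (p + vec d) ∈ S → ¬ G.inp (p + vec d) (neg d) → d ≠ a → d ≠ b →
        G.str p d = 0)) := by
  have hax := across_fst_ne (G := G) p
  have hin := inside_across (G := G) p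
  have hacr := across_add_of_ne (G := G) hin hax
  have hra := rear_add_of_inside_ne (G := G) hin hax
  have hoa := own_add_of_inside (G := G) hin
  have htree : ∀ d, inside p d = false → d ≠ neg (G.heading p) →
      ¬ G.inp (p + vec d) (neg d) → ¬ G.Tree (blk p) d := fun d h1 h2 h3 h4 =>
    h3 (inp_of_tree h1 h2 h4)
  have hperp : ∀ d, d.1 ≠ (G.heading p).1 → d = G.across p ∨ d = neg (G.across p) := by
    intro d hd
    rcases dir_cases (G := G) p d with rfl | rfl | h | h
    · exact absurd rfl hd
    · exact absurd (neg_fst _) hd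
    · exact Or.inl h
    · exact Or.inr h
  have hne : neg (G.across p) ≠ neg (G.heading p) := fun h =>
    hax (by rw [← neg_fst (G.across p), h, neg_fst])
  have hine := inside_neg_across (G := G) p
  have hhin : inside p (G.heading p) = G.rear p := rfl
  have hhne : G.heading p ≠ neg (G.heading p) := (neg_ne _).symm
  rcases ho : G.own p with _ | _ <;> rcases hr : G.rear p with _ | _
  · have hsa : G.str p (G.across p) = 1 := by rw [str_across ho hr]; simp
    have hout : ∀ d, d = neg (G.across p) → ¬ G.inp (p + vec d) (neg d) → G.str p d = 0 := by
      rintro d rfl hni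
      rw [str_neg_across ho hr]
      simp [strength, htree _ hine hne hni]
    by_cases hb : G.Blocked p
    · have hinp : ∀ d, G.inp p d ↔ d = G.across p ∨ d = G.heading p := by
        intro d; simp [inp, ho, hr, hb]
      refine ⟨G.across p, G.heading p, Or.inr ⟨(hinp _).2 (Or.inl rfl), (hinp _).2 (Or.inr rfl),
        hax, hsa, ?_, fun d => (hinp d).1, fun d _ hni h1 h2 => ?_⟩⟩
      · rw [str_heading ho hr]; simp [strength, hb]
      · rcases dir_cases (G := G) p d with h | rfl | h | h
        · exact absurd h h2
        · rw [str_neg_heading ho hr]; simp [strength, hb]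
        · exact absurd h h1
        · exact hout d h hni
    · have hinp : ∀ d, G.inp p d ↔ d = G.across p ∨ d = neg (G.heading p) := by
        intro d; simp [inp, ho, hr, hb]
      refine ⟨G.across p, neg (G.heading p), Or.inr ⟨(hinp _).2 (Or.inl rfl),
        (hinp _).2 (Or.inr rfl), hax, hsa, ?_, fun d => (hinp d).1, fun d _ hni h1 h2 => ?_⟩⟩
      · rw [str_neg_heading ho hr]; simp [strength, hb]
      · rcases dir_cases (G := G) p d with rfl | h | h | h
        · rw [str_heading ho hr]
          simp [strength, hb, htree _ (hhin.trans hr) hhne hni]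
        · exact absurd h h2
        · exact absurd h h1
        · exact hout d h hni
  · have hroot : blk p ≠ G.root := fun h => by
      have := hseed h hr
      rw [ho] at this
      cases this
    have hinp : ∀ d, G.inp p d ↔ d = neg (G.heading p) ∨ d = G.across p := by
      intro d; simp [inp, ho, hr, hroot]
    refine ⟨neg (G.heading p), G.across p, Or.inr ⟨(hinp _).2 (Or.inl rfl),
      (hinp _).2 (Or.inr rfl), fun h => hax h.symm, ?_, ?_, fun d => (hinp d).1,
      fun d _ hni h1 h2 => ?_⟩⟩
    · rw [str_neg_heading ho hr]; simp [strength, tree_pred hp hroot]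
    · rw [str_across ho hr]; simp [hroot]
    · rcases dir_cases (G := G) p d with rfl | h | h | rfl
      · refine absurd ?_ hni
        have hi : inside p (G.heading p) = true := hr
        rw [inp, own_add_of_inside hi, rear_add_of_inside_axis hi rfl, ho, hr,
          heading_add_of_inside hi]
        rfl
      · exact absurd h h1
      · exact absurd h h2
      · rw [str_neg_across ho hr]
        simp [strength, htree _ hine hne hni]
  · have hinp : ∀ d, G.inp p d ↔ d = neg (G.heading p) := by
      intro d; simp [inp, ho, hr]
    have hsn : G.str p (neg (G.across p)) = 1 := by rw [str_neg_across ho hr]; simp [strength]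
    have hsa : G.str p (G.across p) = 1 := by rw [str_across ho hr]; simp
    refine ⟨neg (G.heading p), neg (G.across p), Or.inl ⟨(hinp _).2 rfl, ?_,
      fun d => (hinp d).1, hsn.le, fun d _ hni h1 h2 => ?_, fun d hd => ?_⟩⟩
    · rw [str_neg_heading ho hr]; simp [strength]
    · rcases dir_cases (G := G) p d with rfl | h | rfl | h
      · rw [str_heading ho hr]
        simp [strength, htree _ (hhin.trans hr) hhne hni]
      · exact absurd h h1
      · refine absurd ?_ hni
        rw [inp, hoa, hra, ho, hr, hacr]
        exact Or.inl rfl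
      · exact absurd h h2
    · rcases hperp d hd with rfl | rfl
      · exact hsa
      · exact hsn
  · have hsn : G.str p (neg (G.across p)) = 1 := by rw [str_neg_across ho hr]; simp [strength]
    have hahead : ¬ G.inp (p + vec (G.heading p)) (neg (G.heading p)) → G.Blocked p := by
      intro hni
      by_contra hb
      refine hni ?_
      have hi : inside p (G.heading p) = true := hr
      rw [inp, own_add_of_inside hi, rear_add_of_inside_axis hi rfl, ho, hr,
        heading_add_of_inside hi, Blocked, blk_add_of_inside hi, heading_add_of_inside hi]
      exact Or.inr (Or.inr ⟨hb, rfl⟩)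
    have hsh : G.str p (G.heading p) = 1 ∨ (G.Blocked p ∧ G.str p (G.heading p) = 0) := by
      rw [str_heading ho hr]
      by_cases hb : G.Blocked p <;> simp [strength, hb]
    have hzero : ¬ G.inp (p + vec (G.heading p)) (neg (G.heading p)) →
        G.str p (G.heading p) = 0 := by
      intro hni
      rw [str_heading ho hr]
      simp [strength, hahead hni]
    by_cases hroot : blk p = G.root
    · have hinp : ∀ d, G.inp p d ↔ d = G.across p := by
        intro d; simp [inp, ho, hr, hroot]
      have hbelow : blk p + vec (neg (G.heading p)) ∉ S := fun h => ne_root_of_pred_mem hp h hroot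
      have hnt : ¬ G.Tree (blk p) (neg (G.heading p)) := fun h => hbelow h.1
      refine ⟨G.across p, neg (G.across p), Or.inl ⟨(hinp _).2 rfl, ?_, fun d => (hinp d).1,
        hsn.le, fun d hd hni h1 h2 => ?_, fun d hd => ?_⟩⟩
      · rw [str_across ho hr]; simp [hroot]
      · rcases dir_cases (G := G) p d with rfl | rfl | h | h
        · exact hzero hni
        · rw [blk_add_of_not_inside (not_inside_neg_heading hr)] at hd
          exact absurd hd hbelow
        · exact absurd h h1
        · exact absurd h h2
      · rcases dir_cases (G := G) p d with rfl | rfl | rfl | rfl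
        · exact hsh.resolve_right fun h => h.1.ne_root hroot
        · rw [str_neg_heading ho hr]; rw [hroot] at hnt; simp [strength, hnt, hroot]
        · exact absurd rfl hd
        · exact absurd (neg_fst _) hd
    · have hinp : ∀ d, G.inp p d ↔ d = neg (G.heading p) := by
        intro d; simp [inp, ho, hr, hroot]
      have hsa : G.str p (G.across p) = 1 := by rw [str_across ho hr]; simp [hroot]
      refine ⟨neg (G.heading p), neg (G.across p), Or.inl ⟨(hinp _).2 rfl, ?_,
        fun d => (hinp d).1, hsn.le, fun d _ hni h1 h2 => ?_, fun d hd => ?_⟩⟩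
      · rw [str_neg_heading ho hr]; simp [strength, tree_pred hp hroot]
      · rcases dir_cases (G := G) p d with rfl | h | rfl | h
        · exact hzero hni
        · exact absurd h h1
        · refine absurd ?_ hni
          rw [inp, hoa, hra, ho, hr, hacr, heading_add_of_inside hin, blk_add_of_inside hin]
          exact ⟨hroot, Or.inr rfl⟩
        · exact absurd h h2
      · rcases hperp d hd with rfl | rfl
        · exact hsa
        · exact hsn

end Growth

theorem exists_system {S : Set (ℤ × ℤ)} (hS : IsShape S) : ∃ Sys : RTAS, Sys.temp = 2 ∧
    SinglySeeded Sys ∧ MismatchFree Sys ∧ StrictlySelfAssembles Sys (scaleShape S 2) := by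
  obtain ⟨G⟩ := nonempty_growth hS
  obtain ⟨s, hsb, hsi, hsc⟩ := Growth.exists_seed G.root (G.dir G.root)
  have hsr : G.rear s = true := by rw [Growth.rear, Growth.heading, hsb, hsi]
  have hso : G.own s = false := by rw [Growth.own, Growth.heading, hsb, hsc]
  have hfin : (scaleShape S 2).Finite := by
    have hsub : scaleShape S 2 ⊆ ⋃ b ∈ S, Set.Icc (2 * b.1) (2 * b.1 + 1) ×ˢ
        Set.Icc (2 * b.2) (2 * b.2 + 1) := by
      intro p hp
      rw [mem_scaleShape_two] at hp
      refine Set.mem_biUnion hp ⟨⟨?_, ?_⟩, ?_, ?_⟩ <;> simp only [blk] <;> omega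
    exact (hS.1.biUnion fun b _ => (Set.finite_Icc _ _).prod (Set.finite_Icc _ _)).subset hsub
  let P : Blueprint (scaleShape S 2) ((ℕ ×ₗ ℕ) ×ₗ ℕ) :=
    { seed := s
      str := G.str
      inp := G.inp
      rank := fun p => toLex (G.time (blk p), G.stage p)
      seed_mem := by rw [mem_scaleShape_two, hsb]; exact G.root_mem
      str_symm := fun p d hp hq => Growth.str_symm (mem_scaleShape_two.1 hp)
        (mem_scaleShape_two.1 hq)
      inp_mem := fun p d hp hd =>
        mem_scaleShape_two.2 (Growth.inp_spec (mem_scaleShape_two.1 hp) hd).1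
      inp_rank := fun p d hp hd =>
        Prod.Lex.lt_iff.2 (Growth.inp_spec (mem_scaleShape_two.1 hp) hd).2
      between := fun p d h h' => mem_scaleShape_two.2
        (between_blk (mem_scaleShape_two.1 h) (mem_scaleShape_two.1 h'))
      attachable := fun p hp hps => by
        simp only [mem_scaleShape_two] at hp ⊢
        refine Growth.attachable hp fun h1 h2 => ?_
        by_contra h3
        exact hps (Growth.seed_unique (G := G) (by rw [h1, hsb])
          (by rw [hso, Bool.eq_false_of_not_eq_true h3]) (by rw [hsr, h2])) }
  refine P.assembles hfin wellFounded_lt fun d hd => ?_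
  have hd : G.inp s d := hd
  rw [Growth.inp, hso, hsr] at hd
  exact hd.1 hsb

end RTAM

/-- For every finite connected shape `S`, the 2-scaling of `S` strictly
self-assembles in some singly seeded mismatch-free temperature-2 RTAM system. -/
theorem rtam_temp2_scale2_shapes
    (S : Set (ℤ × ℤ)) (hS : IsShape S) :
    ∃ Sys : RTAS, Sys.temp = 2 ∧ SinglySeeded Sys ∧ MismatchFree Sys ∧
      StrictlySelfAssembles Sys (scaleShape S 2) := by
  exact RTAM.exists_system hS
end
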